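/- Soundness of the call-by-value linear-use CPS translation: if Θ ⊢ M =_{λc} N : τ, then Θᵛᶜ ⊢ Mᵛᶜ = Nᵛᶜ : (τᵛᶜ ⇒ R̲) ⊸ R̲ in the equational theory of EEC. -/

import Mathlib

set_option autoImplicit false

namespace EEC

/-! # The enriched effect calculus (EEC)

A deep embedding of the enriched effect calculus of Egger, Møgelberg and
Simpson: value types and computation types, raw terms (de Bruijn indices for
value variables, together with a designated stoup variable `svar`), typing
derivations with an (at most singleton) stoup, the βη-equational theory, the
simply-typed λ-calculus together with βη-equality and Moggi's computational
λ-calculus equality, the standard cbv/cbn translations of typed λ-calculus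
into EEC, Hasegawa's linear-use CPS translations, and the generic linear-use
CPS self-translation of EEC. -/

mutual
  /-- Value types of EEC. -/
  inductive VType : Type
    | base : ℕ → VType                 -- value type constants α
    | unit : VType                     -- 1
    | prod : VType → VType → VType     -- A × B
    | arr : VType → VType → VType      -- A → B
    | comp : CType → VType             -- every computation type is a value type
    | lin : CType → CType → VType      -- A̲ ⊸ B̲
  /-- Computation types of EEC. -/
  inductive CType : Type
    | base : ℕ → CType                 -- computation type constants α̲
    | cunit : CType                    -- 1̲
    | cand : CType → CType → CType     -- A̲ & B̲
    | carr : VType → CType → CType     -- A ⇒ B̲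
    | iunit : CType                    -- I̲
    | bang : VType → CType             -- !A
    | copow : VType → CType → CType    -- !A ⊗ B̲
    | czero : CType                    -- 0̲
    | csum : CType → CType → CType     -- A̲ ⊕ B̲
end

/-- Raw terms of EEC.  Value variables are de Bruijn indices (`var n`, with
`var 0` the innermost bound variable); the unique stoup variable is `svar`
(the constructs `llam`, `copowlet` (in its body) and `ccase` (in its
branches) bind the stoup variable). -/
inductive Tm : Type
  | var : ℕ → Tm                -- value variable
  | svar : Tm                   -- the stoup variable
  | unit : Tm                   -- * : 1
  | vpair : Tm → Tm → Tm        -- ⟨t,u⟩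
  | vfst : Tm → Tm
  | vsnd : Tm → Tm
  | vlam : VType → Tm → Tm      -- λx:A. t
  | vapp : Tm → Tm → Tm
  | cunit : Tm                  -- ⋆ : 1̲
  | cpair : Tm → Tm → Tm        -- ⟨t,u⟩ : A̲ & B̲
  | cfst : Tm → Tm
  | csnd : Tm → Tm
  | clam : VType → Tm → Tm      -- λx:A ⇒ t
  | capp : Tm → Tm → Tm         -- s ⋅ t
  | top : Tm                    -- ⊤ : I̲
  | ilet : Tm → Tm → Tm         -- t to ⊤. u
  | bang : Tm → Tm              -- !t
  | banglet : Tm → Tm → Tm      -- let !x = t in u   (binds a value variable in u)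
  | copow : Tm → Tm → Tm        -- !t ⊗ u
  | copowlet : Tm → Tm → Tm     -- let !x⊗y = s in t (binds a value variable and the stoup variable in t)
  | cimage : CType → Tm → Tm    -- image_{A̲}(t)
  | cinl : Tm → Tm
  | cinr : Tm → Tm
  | ccase : Tm → Tm → Tm → Tm   -- case s of (x. t | y. u)  (branches bind the stoup variable)
  | llam : CType → Tm → Tm      -- λ°z:A̲. t (binds the stoup variable)
  | lapp : Tm → Tm → Tm         -- s[t]

namespace Tm

/-- Lift a renaming of value variables under a binder. -/
def liftN (f : ℕ → ℕ) : ℕ → ℕ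
  | 0 => 0
  | n + 1 => f n + 1

/-- Renaming of value variables. -/
def rename (f : ℕ → ℕ) : Tm → Tm
  | .var n => .var (f n)
  | .svar => .svar
  | .unit => .unit
  | .vpair t u => .vpair (rename f t) (rename f u)
  | .vfst t => .vfst (rename f t)
  | .vsnd t => .vsnd (rename f t)
  | .vlam A t => .vlam A (rename (liftN f) t)
  | .vapp s t => .vapp (rename f s) (rename f t)
  | .cunit => .cunit
  | .cpair t u => .cpair (rename f t) (rename f u)
  | .cfst t => .cfst (rename f t)
  | .csnd t => .csnd (rename f t)
  | .clam A t => .clam A (rename (liftN f) t)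
  | .capp s t => .capp (rename f s) (rename f t)
  | .top => .top
  | .ilet t u => .ilet (rename f t) (rename f u)
  | .bang t => .bang (rename f t)
  | .banglet t u => .banglet (rename f t) (rename (liftN f) u)
  | .copow t u => .copow (rename f t) (rename f u)
  | .copowlet s t => .copowlet (rename f s) (rename (liftN f) t)
  | .cimage A t => .cimage A (rename f t)
  | .cinl t => .cinl (rename f t)
  | .cinr t => .cinr (rename f t)
  | .ccase s t u => .ccase (rename f s) (rename f t) (rename f u)
  | .llam A t => .llam A (rename f t)
  | .lapp s t => .lapp (rename f s) (rename f t)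

/-- Weakening of value variables. -/
def shift (t : Tm) : Tm := rename Nat.succ t

/-- Lift a parallel substitution of value variables under a binder. -/
def liftS (σ : ℕ → Tm) : ℕ → Tm
  | 0 => .var 0
  | n + 1 => shift (σ n)

/-- Parallel (capture-avoiding) substitution for value variables. -/
def psubst (σ : ℕ → Tm) : Tm → Tm
  | .var n => σ n
  | .svar => .svar
  | .unit => .unit
  | .vpair t u => .vpair (psubst σ t) (psubst σ u)
  | .vfst t => .vfst (psubst σ t)
  | .vsnd t => .vsnd (psubst σ t)
  | .vlam A t => .vlam A (psubst (liftS σ) t)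
  | .vapp s t => .vapp (psubst σ s) (psubst σ t)
  | .cunit => .cunit
  | .cpair t u => .cpair (psubst σ t) (psubst σ u)
  | .cfst t => .cfst (psubst σ t)
  | .csnd t => .csnd (psubst σ t)
  | .clam A t => .clam A (psubst (liftS σ) t)
  | .capp s t => .capp (psubst σ s) (psubst σ t)
  | .top => .top
  | .ilet t u => .ilet (psubst σ t) (psubst σ u)
  | .bang t => .bang (psubst σ t)
  | .banglet t u => .banglet (psubst σ t) (psubst (liftS σ) u)
  | .copow t u => .copow (psubst σ t) (psubst σ u)
  | .copowlet s t => .copowlet (psubst σ s) (psubst (liftS σ) t)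
  | .cimage A t => .cimage A (psubst σ t)
  | .cinl t => .cinl (psubst σ t)
  | .cinr t => .cinr (psubst σ t)
  | .ccase s t u => .ccase (psubst σ s) (psubst σ t) (psubst σ u)
  | .llam A t => .llam A (psubst σ t)
  | .lapp s t => .lapp (psubst σ s) (psubst σ t)

/-- Capture-avoiding substitution `t[u/x]` of a term `u` for the innermost
value variable of `t`. -/
def subst0 (u : Tm) (t : Tm) : Tm :=
  psubst (fun n => match n with | 0 => u | m + 1 => .var m) t

/-- Capture-avoiding substitution `t[u/z]` of a term `u` for the stoup
variable of `t`.  The substitution stops at the stoup-variable binders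
(`llam`-bodies, `copowlet`-bodies and `ccase`-branches). -/
def ssubst (u : Tm) : Tm → Tm
  | .var n => .var n
  | .svar => u
  | .unit => .unit
  | .vpair t t' => .vpair (ssubst u t) (ssubst u t')
  | .vfst t => .vfst (ssubst u t)
  | .vsnd t => .vsnd (ssubst u t)
  | .vlam A t => .vlam A (ssubst (shift u) t)
  | .vapp s t => .vapp (ssubst u s) (ssubst u t)
  | .cunit => .cunit
  | .cpair t t' => .cpair (ssubst u t) (ssubst u t')
  | .cfst t => .cfst (ssubst u t)
  | .csnd t => .csnd (ssubst u t)
  | .clam A t => .clam A (ssubst (shift u) t)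
  | .capp s t => .capp (ssubst u s) (ssubst u t)
  | .top => .top
  | .ilet t t' => .ilet (ssubst u t) (ssubst u t')
  | .bang t => .bang (ssubst u t)
  | .banglet t t' => .banglet (ssubst u t) (ssubst (shift u) t')
  | .copow t t' => .copow (ssubst u t) (ssubst u t')
  | .copowlet s t => .copowlet (ssubst u s) t
  | .cimage A t => .cimage A (ssubst u t)
  | .cinl t => .cinl (ssubst u t)
  | .cinr t => .cinr (ssubst u t)
  | .ccase s t t' => .ccase (ssubst u s) t t'
  | .llam A t => .llam A t
  | .lapp s t => .lapp (ssubst u s) (ssubst u t)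

end Tm

/-- Typing derivations of EEC (Figure 1 of the paper).  `Deriv Γ none t A`
is the judgement `Γ ⊢ t : A` (empty stoup); `Deriv Γ (some A̲) t (.comp B̲)`
is the judgement `Γ | z:A̲ ⊢ t : B̲`.  In the rules below `Δ` ranges over an
arbitrary (possibly empty) stoup. -/
inductive Deriv : List VType → Option CType → Tm → VType → Type
  | var (Γ : List VType) (n : ℕ) (A : VType) :
      Γ[n]? = some A → Deriv Γ none (.var n) A
  | svar (Γ : List VType) (A : CType) : Deriv Γ (some A) .svar (.comp A)
  | unit (Γ : List VType) : Deriv Γ none .unit .unit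
  | vpair (Γ : List VType) (t u : Tm) (A B : VType) :
      Deriv Γ none t A → Deriv Γ none u B → Deriv Γ none (.vpair t u) (.prod A B)
  | vfst (Γ : List VType) (t : Tm) (A B : VType) :
      Deriv Γ none t (.prod A B) → Deriv Γ none (.vfst t) A
  | vsnd (Γ : List VType) (t : Tm) (A B : VType) :
      Deriv Γ none t (.prod A B) → Deriv Γ none (.vsnd t) B
  | vlam (Γ : List VType) (t : Tm) (A B : VType) :
      Deriv (A :: Γ) none t B → Deriv Γ none (.vlam A t) (.arr A B)
  | vapp (Γ : List VType) (s t : Tm) (A B : VType) :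
      Deriv Γ none s (.arr A B) → Deriv Γ none t A → Deriv Γ none (.vapp s t) B
  | cunit (Γ : List VType) (Δ : Option CType) : Deriv Γ Δ .cunit (.comp .cunit)
  | cpair (Γ : List VType) (Δ : Option CType) (t u : Tm) (A B : CType) :
      Deriv Γ Δ t (.comp A) → Deriv Γ Δ u (.comp B) →
      Deriv Γ Δ (.cpair t u) (.comp (.cand A B))
  | cfst (Γ : List VType) (Δ : Option CType) (t : Tm) (A B : CType) :
      Deriv Γ Δ t (.comp (.cand A B)) → Deriv Γ Δ (.cfst t) (.comp A)
  | csnd (Γ : List VType) (Δ : Option CType) (t : Tm) (A B : CType) :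
      Deriv Γ Δ t (.comp (.cand A B)) → Deriv Γ Δ (.csnd t) (.comp B)
  | clam (Γ : List VType) (Δ : Option CType) (t : Tm) (A : VType) (B : CType) :
      Deriv (A :: Γ) Δ t (.comp B) → Deriv Γ Δ (.clam A t) (.comp (.carr A B))
  | capp (Γ : List VType) (Δ : Option CType) (s t : Tm) (A : VType) (B : CType) :
      Deriv Γ Δ s (.comp (.carr A B)) → Deriv Γ none t A →
      Deriv Γ Δ (.capp s t) (.comp B)
  | top (Γ : List VType) : Deriv Γ none .top (.comp .iunit)
  | ilet (Γ : List VType) (Δ : Option CType) (t u : Tm) (A : CType) :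
      Deriv Γ Δ t (.comp .iunit) → Deriv Γ none u (.comp A) →
      Deriv Γ Δ (.ilet t u) (.comp A)
  | bang (Γ : List VType) (t : Tm) (A : VType) :
      Deriv Γ none t A → Deriv Γ none (.bang t) (.comp (.bang A))
  | banglet (Γ : List VType) (Δ : Option CType) (t u : Tm) (A : VType) (B : CType) :
      Deriv Γ Δ t (.comp (.bang A)) → Deriv (A :: Γ) none u (.comp B) →
      Deriv Γ Δ (.banglet t u) (.comp B)
  | copow (Γ : List VType) (Δ : Option CType) (t u : Tm) (A : VType) (B : CType) :
      Deriv Γ none t A → Deriv Γ Δ u (.comp B) →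
      Deriv Γ Δ (.copow t u) (.comp (.copow A B))
  | copowlet (Γ : List VType) (Δ : Option CType) (s t : Tm) (A : VType) (B C : CType) :
      Deriv Γ Δ s (.comp (.copow A B)) → Deriv (A :: Γ) (some B) t (.comp C) →
      Deriv Γ Δ (.copowlet s t) (.comp C)
  | cimage (Γ : List VType) (Δ : Option CType) (t : Tm) (A : CType) :
      Deriv Γ Δ t (.comp .czero) → Deriv Γ Δ (.cimage A t) (.comp A)
  | cinl (Γ : List VType) (Δ : Option CType) (t : Tm) (A B : CType) :
      Deriv Γ Δ t (.comp A) → Deriv Γ Δ (.cinl t) (.comp (.csum A B))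
  | cinr (Γ : List VType) (Δ : Option CType) (t : Tm) (A B : CType) :
      Deriv Γ Δ t (.comp B) → Deriv Γ Δ (.cinr t) (.comp (.csum A B))
  | ccase (Γ : List VType) (Δ : Option CType) (s t u : Tm) (A B C : CType) :
      Deriv Γ Δ s (.comp (.csum A B)) → Deriv Γ (some A) t (.comp C) →
      Deriv Γ (some B) u (.comp C) → Deriv Γ Δ (.ccase s t u) (.comp C)
  | llam (Γ : List VType) (t : Tm) (A B : CType) :
      Deriv Γ (some A) t (.comp B) → Deriv Γ none (.llam A t) (.lin A B)
  | lapp (Γ : List VType) (Δ : Option CType) (s t : Tm) (A B : CType) :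
      Deriv Γ none s (.lin A B) → Deriv Γ Δ t (.comp A) →
      Deriv Γ Δ (.lapp s t) (.comp B)

/-- The equational theory of EEC: the smallest type-respecting congruence
containing the βη-equalities of Figure 2 of the paper. -/
inductive EEq : List VType → Option CType → Tm → Tm → VType → Prop
  -- equivalence
  | refl {Γ Δ t A} : Deriv Γ Δ t A → EEq Γ Δ t t A
  | symm {Γ Δ t u A} : EEq Γ Δ t u A → EEq Γ Δ u t A
  | trans {Γ Δ t u v A} : EEq Γ Δ t u A → EEq Γ Δ u v A → EEq Γ Δ t v A
  -- congruence rules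
  | vpair_cong {Γ t t' u u' A B} : EEq Γ none t t' A → EEq Γ none u u' B →
      EEq Γ none (.vpair t u) (.vpair t' u') (.prod A B)
  | vfst_cong {Γ t t' A B} : EEq Γ none t t' (.prod A B) →
      EEq Γ none (.vfst t) (.vfst t') A
  | vsnd_cong {Γ t t' A B} : EEq Γ none t t' (.prod A B) →
      EEq Γ none (.vsnd t) (.vsnd t') B
  | vlam_cong {Γ t t' A B} : EEq (A :: Γ) none t t' B →
      EEq Γ none (.vlam A t) (.vlam A t') (.arr A B)
  | vapp_cong {Γ s s' t t' A B} : EEq Γ none s s' (.arr A B) → EEq Γ none t t' A →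
      EEq Γ none (.vapp s t) (.vapp s' t') B
  | cpair_cong {Γ Δ t t' u u' A B} : EEq Γ Δ t t' (.comp A) → EEq Γ Δ u u' (.comp B) →
      EEq Γ Δ (.cpair t u) (.cpair t' u') (.comp (.cand A B))
  | cfst_cong {Γ Δ t t' A B} : EEq Γ Δ t t' (.comp (.cand A B)) →
      EEq Γ Δ (.cfst t) (.cfst t') (.comp A)
  | csnd_cong {Γ Δ t t' A B} : EEq Γ Δ t t' (.comp (.cand A B)) →
      EEq Γ Δ (.csnd t) (.csnd t') (.comp B)
  | clam_cong {Γ Δ t t' A B} : EEq (A :: Γ) Δ t t' (.comp B) →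
      EEq Γ Δ (.clam A t) (.clam A t') (.comp (.carr A B))
  | capp_cong {Γ Δ s s' t t' A B} : EEq Γ Δ s s' (.comp (.carr A B)) → EEq Γ none t t' A →
      EEq Γ Δ (.capp s t) (.capp s' t') (.comp B)
  | ilet_cong {Γ Δ t t' u u' A} : EEq Γ Δ t t' (.comp .iunit) → EEq Γ none u u' (.comp A) →
      EEq Γ Δ (.ilet t u) (.ilet t' u') (.comp A)
  | bang_cong {Γ t t' A} : EEq Γ none t t' A →
      EEq Γ none (.bang t) (.bang t') (.comp (.bang A))
  | banglet_cong {Γ Δ t t' u u' A B} : EEq Γ Δ t t' (.comp (.bang A)) →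
      EEq (A :: Γ) none u u' (.comp B) →
      EEq Γ Δ (.banglet t u) (.banglet t' u') (.comp B)
  | copow_cong {Γ Δ t t' u u' A B} : EEq Γ none t t' A → EEq Γ Δ u u' (.comp B) →
      EEq Γ Δ (.copow t u) (.copow t' u') (.comp (.copow A B))
  | copowlet_cong {Γ Δ s s' t t' A B C} : EEq Γ Δ s s' (.comp (.copow A B)) →
      EEq (A :: Γ) (some B) t t' (.comp C) →
      EEq Γ Δ (.copowlet s t) (.copowlet s' t') (.comp C)
  | cimage_cong {Γ Δ t t' A} : EEq Γ Δ t t' (.comp .czero) →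
      EEq Γ Δ (.cimage A t) (.cimage A t') (.comp A)
  | cinl_cong {Γ Δ t t' A B} : EEq Γ Δ t t' (.comp A) →
      EEq Γ Δ (.cinl t) (.cinl t') (.comp (.csum A B))
  | cinr_cong {Γ Δ t t' A B} : EEq Γ Δ t t' (.comp B) →
      EEq Γ Δ (.cinr t) (.cinr t') (.comp (.csum A B))
  | ccase_cong {Γ Δ s s' t t' u u' A B C} : EEq Γ Δ s s' (.comp (.csum A B)) →
      EEq Γ (some A) t t' (.comp C) → EEq Γ (some B) u u' (.comp C) →
      EEq Γ Δ (.ccase s t u) (.ccase s' t' u') (.comp C)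
  | llam_cong {Γ t t' A B} : EEq Γ (some A) t t' (.comp B) →
      EEq Γ none (.llam A t) (.llam A t') (.lin A B)
  | lapp_cong {Γ Δ s s' t t' A B} : EEq Γ none s s' (.lin A B) → EEq Γ Δ t t' (.comp A) →
      EEq Γ Δ (.lapp s t) (.lapp s' t') (.comp B)
  -- the equalities of Figure 2
  | unit_eta {Γ t} : Deriv Γ none t .unit → EEq Γ none t .unit .unit
  | vfst_beta {Γ t u A B} : Deriv Γ none t A → Deriv Γ none u B →
      EEq Γ none (.vfst (.vpair t u)) t A
  | vsnd_beta {Γ t u A B} : Deriv Γ none t A → Deriv Γ none u B →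
      EEq Γ none (.vsnd (.vpair t u)) u B
  | vpair_eta {Γ t A B} : Deriv Γ none t (.prod A B) →
      EEq Γ none (.vpair (.vfst t) (.vsnd t)) t (.prod A B)
  | vlam_beta {Γ t u A B} : Deriv (A :: Γ) none t B → Deriv Γ none u A →
      EEq Γ none (.vapp (.vlam A t) u) (Tm.subst0 u t) B
  | vlam_eta {Γ t A B} : Deriv Γ none t (.arr A B) →
      EEq Γ none (.vlam A (.vapp (Tm.shift t) (.var 0))) t (.arr A B)
  | cunit_eta {Γ Δ t} : Deriv Γ Δ t (.comp .cunit) → EEq Γ Δ t .cunit (.comp .cunit)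
  | cfst_beta {Γ Δ t u A B} : Deriv Γ Δ t (.comp A) → Deriv Γ Δ u (.comp B) →
      EEq Γ Δ (.cfst (.cpair t u)) t (.comp A)
  | csnd_beta {Γ Δ t u A B} : Deriv Γ Δ t (.comp A) → Deriv Γ Δ u (.comp B) →
      EEq Γ Δ (.csnd (.cpair t u)) u (.comp B)
  | cpair_eta {Γ Δ t A B} : Deriv Γ Δ t (.comp (.cand A B)) →
      EEq Γ Δ (.cpair (.cfst t) (.csnd t)) t (.comp (.cand A B))
  | clam_beta {Γ Δ t u A B} : Deriv (A :: Γ) Δ t (.comp B) → Deriv Γ none u A →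
      EEq Γ Δ (.capp (.clam A t) u) (Tm.subst0 u t) (.comp B)
  | clam_eta {Γ Δ t A B} : Deriv Γ Δ t (.comp (.carr A B)) →
      EEq Γ Δ (.clam A (.capp (Tm.shift t) (.var 0))) t (.comp (.carr A B))
  | ilet_beta {Γ t A} : Deriv Γ none t (.comp A) →
      EEq Γ none (.ilet .top t) t (.comp A)
  | ilet_eta {Γ Δ t u A} : Deriv Γ Δ t (.comp .iunit) → Deriv Γ (some .iunit) u (.comp A) →
      EEq Γ Δ (.ilet t (Tm.ssubst .top u)) (Tm.ssubst t u) (.comp A)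
  | bang_beta {Γ t u A B} : Deriv Γ none t A → Deriv (A :: Γ) none u (.comp B) →
      EEq Γ none (.banglet (.bang t) u) (Tm.subst0 t u) (.comp B)
  | bang_eta {Γ Δ t u A B} : Deriv Γ Δ t (.comp (.bang A)) →
      Deriv Γ (some (.bang A)) u (.comp B) →
      EEq Γ Δ (.banglet t (Tm.ssubst (.bang (.var 0)) (Tm.shift u))) (Tm.ssubst t u) (.comp B)
  | copow_beta {Γ Δ t s u A B C} : Deriv Γ none t A → Deriv Γ Δ s (.comp B) →
      Deriv (A :: Γ) (some B) u (.comp C) →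
      EEq Γ Δ (.copowlet (.copow t s) u) (Tm.ssubst s (Tm.subst0 t u)) (.comp C)
  | copow_eta {Γ Δ t u A B C} : Deriv Γ Δ t (.comp (.copow A B)) →
      Deriv Γ (some (.copow A B)) u (.comp C) →
      EEq Γ Δ (.copowlet t (Tm.ssubst (.copow (.var 0) .svar) (Tm.shift u))) (Tm.ssubst t u) (.comp C)
  | czero_eta {Γ Δ t u A} : Deriv Γ Δ t (.comp .czero) → Deriv Γ (some .czero) u (.comp A) →
      EEq Γ Δ (.cimage A t) (Tm.ssubst t u) (.comp A)
  | csum_beta_inl {Γ Δ t u u' A B C} : Deriv Γ (some A) u (.comp C) →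
      Deriv Γ (some B) u' (.comp C) → Deriv Γ Δ t (.comp A) →
      EEq Γ Δ (.ccase (.cinl t) u u') (Tm.ssubst t u) (.comp C)
  | csum_beta_inr {Γ Δ t u u' A B C} : Deriv Γ (some A) u (.comp C) →
      Deriv Γ (some B) u' (.comp C) → Deriv Γ Δ t (.comp B) →
      EEq Γ Δ (.ccase (.cinr t) u u') (Tm.ssubst t u') (.comp C)
  | csum_eta {Γ Δ t u A B C} : Deriv Γ Δ t (.comp (.csum A B)) →
      Deriv Γ (some (.csum A B)) u (.comp C) →
      EEq Γ Δ (.ccase t (Tm.ssubst (.cinl .svar) u) (Tm.ssubst (.cinr .svar) u)) (Tm.ssubst t u) (.comp C)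
  | llam_beta {Γ Δ t u A B} : Deriv Γ (some A) t (.comp B) → Deriv Γ Δ u (.comp A) →
      EEq Γ Δ (.lapp (.llam A t) u) (Tm.ssubst u t) (.comp B)
  | llam_eta {Γ t A B} : Deriv Γ none t (.lin A B) →
      EEq Γ none (.llam A (.lapp t .svar)) t (.lin A B)

end EEC

namespace EEC

/-! ## The generic linear-use CPS self-translation of EEC (Figures 4–6) -/

mutual
  /-- CPS translation `Aᶜ` of value types, relative to the result type `R̲`. -/
  def cpsV (R : CType) : VType → VType
    | .base a => .base a
    | .unit => .unit
    | .prod A B => .prod (cpsV R A) (cpsV R B)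
    | .arr A B => .arr (cpsV R A) (cpsV R B)
    | .comp A => .lin (cpsC R A) R
    | .lin A B => .lin (cpsC R B) (cpsC R A)
  /-- CPS translation `A̲ᶜ` of computation types, relative to the result type
  `R̲` (a computation-type constant equal to `R̲` is translated to `I̲`). -/
  def cpsC (R : CType) : CType → CType
    | .base a =>
        match R with
        | .base b => if b = a then .iunit else .base a
        | _ => .base a
    | .cunit => .czero
    | .cand A B => .csum (cpsC R A) (cpsC R B)
    | .carr A B => .copow (cpsV R A) (cpsC R B)
    | .iunit => R
    | .bang A => .carr (cpsV R A) R
    | .copow A B => .carr (cpsV R A) (cpsC R B)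
    | .czero => .cunit
    | .csum A B => .cand (cpsC R A) (cpsC R B)
end

/-- Pointwise CPS translation `Γᶜ` of a context. -/
def cpsCtx (R : CType) (Γ : List VType) : List VType := Γ.map (cpsV R)

/-- The generic linear-use CPS self-translation on terms (Figures 5 and 6 of
the paper), defined by recursion on typing derivations.  A value judgement
`Γ ⊢ t : A` is sent to a term `tᶜ` with `Γᶜ ⊢ tᶜ : Aᶜ`, and a stoup
judgement `Γ | z:A̲ ⊢ t : B̲` is sent (contravariantly) to a term `tᶜ` with
`Γᶜ | k_z:B̲ᶜ ⊢ tᶜ : A̲ᶜ`. -/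
def cps (R : CType) : {Γ : List VType} → {Δ : Option CType} → {t : Tm} → {A : VType} →
    Deriv Γ Δ t A → Tm
  | _, _, _, _, .var _ n _ _ => .var n
  | _, _, _, _, .svar _ _ => .svar
  | _, _, _, _, .unit _ => .unit
  | _, _, _, _, .vpair _ _ _ _ _ d1 d2 => .vpair (cps R d1) (cps R d2)
  | _, _, _, _, .vfst _ _ _ _ d => .vfst (cps R d)
  | _, _, _, _, .vsnd _ _ _ _ d => .vsnd (cps R d)
  | _, _, _, _, .vlam _ _ A _ d => .vlam (cpsV R A) (cps R d)
  | _, _, _, _, .vapp _ _ _ _ _ d1 d2 => .vapp (cps R d1) (cps R d2)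
  | _, _, _, _, .cunit _ none => .llam .czero (.cimage R .svar)
  | _, _, _, _, .cunit _ (some D) => .cimage (cpsC R D) .svar
  | _, _, _, _, .cpair _ none _ _ A B d1 d2 =>
      .llam (.csum (cpsC R A) (cpsC R B))
        (.ccase .svar (.lapp (cps R d1) .svar) (.lapp (cps R d2) .svar))
  | _, _, _, _, .cpair _ (some _) _ _ _ _ d1 d2 => .ccase .svar (cps R d1) (cps R d2)
  | _, _, _, _, .cfst _ none _ A _ d => .llam (cpsC R A) (.lapp (cps R d) (.cinl .svar))
  | _, _, _, _, .cfst _ (some _) _ _ _ d => Tm.ssubst (.cinl .svar) (cps R d)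
  | _, _, _, _, .csnd _ none _ _ B d => .llam (cpsC R B) (.lapp (cps R d) (.cinr .svar))
  | _, _, _, _, .csnd _ (some _) _ _ _ d => Tm.ssubst (.cinr .svar) (cps R d)
  | _, _, _, _, .clam _ none _ A B d =>
      .llam (.copow (cpsV R A) (cpsC R B)) (.copowlet .svar (.lapp (cps R d) .svar))
  | _, _, _, _, .clam _ (some _) _ _ _ d => .copowlet .svar (cps R d)
  | _, _, _, _, .capp _ none _ _ _ B d1 d2 =>
      .llam (cpsC R B) (.lapp (cps R d1) (.copow (cps R d2) .svar))
  | _, _, _, _, .capp _ (some _) _ _ _ _ d1 d2 =>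
      Tm.ssubst (.copow (cps R d2) .svar) (cps R d1)
  | _, _, _, _, .top _ => .llam R .svar
  | _, _, _, _, .ilet _ none _ _ A d1 d2 =>
      .llam (cpsC R A) (.lapp (cps R d1) (.lapp (cps R d2) .svar))
  | _, _, _, _, .ilet _ (some _) _ _ _ d1 d2 =>
      Tm.ssubst (.lapp (cps R d2) .svar) (cps R d1)
  | _, _, _, _, .bang _ _ A d => .llam (.carr (cpsV R A) R) (.capp .svar (cps R d))
  | _, _, _, _, .banglet _ none _ _ A B d1 d2 =>
      .llam (cpsC R B) (.lapp (cps R d1) (.clam (cpsV R A) (.lapp (cps R d2) .svar)))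
  | _, _, _, _, .banglet _ (some _) _ _ A _ d1 d2 =>
      Tm.ssubst (.clam (cpsV R A) (.lapp (cps R d2) .svar)) (cps R d1)
  | _, _, _, _, .copow _ none _ _ A B d1 d2 =>
      .llam (.carr (cpsV R A) (cpsC R B)) (.lapp (cps R d2) (.capp .svar (cps R d1)))
  | _, _, _, _, .copow _ (some _) _ _ _ _ d1 d2 =>
      Tm.ssubst (.capp .svar (cps R d1)) (cps R d2)
  | _, _, _, _, .copowlet _ none _ _ A _ C d1 d2 =>
      .llam (cpsC R C) (.lapp (cps R d1) (.clam (cpsV R A) (cps R d2)))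
  | _, _, _, _, .copowlet _ (some _) _ _ A _ _ d1 d2 =>
      Tm.ssubst (.clam (cpsV R A) (cps R d2)) (cps R d1)
  | _, _, _, _, .cimage _ none _ A d => .llam (cpsC R A) (.lapp (cps R d) .cunit)
  | _, _, _, _, .cimage _ (some _) _ _ d => Tm.ssubst .cunit (cps R d)
  | _, _, _, _, .cinl _ none _ A B d =>
      .llam (.cand (cpsC R A) (cpsC R B)) (.lapp (cps R d) (.cfst .svar))
  | _, _, _, _, .cinl _ (some _) _ _ _ d => Tm.ssubst (.cfst .svar) (cps R d)
  | _, _, _, _, .cinr _ none _ A B d =>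
      .llam (.cand (cpsC R A) (cpsC R B)) (.lapp (cps R d) (.csnd .svar))
  | _, _, _, _, .cinr _ (some _) _ _ _ d => Tm.ssubst (.csnd .svar) (cps R d)
  | _, _, _, _, .ccase _ none _ _ _ _ _ C d1 d2 d3 =>
      .llam (cpsC R C) (.lapp (cps R d1) (.cpair (cps R d2) (cps R d3)))
  | _, _, _, _, .ccase _ (some _) _ _ _ _ _ _ d1 d2 d3 =>
      Tm.ssubst (.cpair (cps R d2) (cps R d3)) (cps R d1)
  | _, _, _, _, .llam _ _ _ B d => .llam (cpsC R B) (cps R d)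
  | _, _, _, _, .lapp _ none _ _ _ B d1 d2 =>
      .llam (cpsC R B) (.lapp (cps R d2) (.lapp (cps R d1) .svar))
  | _, _, _, _, .lapp _ (some _) _ _ _ _ d1 d2 =>
      Tm.ssubst (.lapp (cps R d1) .svar) (cps R d2)

end EEC

namespace EEC

/-! ## The type isomorphisms `ι` of Figure 7, with explicit inverses -/

mutual
  /-- The closed term `ι_A : (Aᶜ)ᶜ → A` (Figure 7). -/
  def iotaV (R : CType) : VType → Tm
    | .base a => .vlam (.base a) (.var 0)
    | .unit => .vlam .unit .unit
    | .prod A B => .vlam (cpsV R (cpsV R (.prod A B)))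
        (.vpair (.vapp (iotaV R A) (.vfst (.var 0))) (.vapp (iotaV R B) (.vsnd (.var 0))))
    | .arr A B => .vlam (cpsV R (cpsV R (.arr A B)))
        (.vlam A (.vapp (iotaV R B) (.vapp (.var 1) (.vapp (iotaVinv R A) (.var 0)))))
    | .comp A => .vlam (cpsV R (cpsV R (.comp A)))
        (.lapp (iotaC R A) (.lapp (.var 0) .top))
    | .lin A B => .vlam (cpsV R (cpsV R (.lin A B)))
        (.llam A (.lapp (iotaC R B) (.lapp (.var 0) (.lapp (iotaCinv R A) .svar))))
  /-- The closed term `ι_A⁻¹ : A → (Aᶜ)ᶜ`. -/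
  def iotaVinv (R : CType) : VType → Tm
    | .base a => .vlam (.base a) (.var 0)
    | .unit => .vlam .unit .unit
    | .prod A B => .vlam (.prod A B)
        (.vpair (.vapp (iotaVinv R A) (.vfst (.var 0))) (.vapp (iotaVinv R B) (.vsnd (.var 0))))
    | .arr A B => .vlam (.arr A B)
        (.vlam (cpsV R (cpsV R A)) (.vapp (iotaVinv R B) (.vapp (.var 1) (.vapp (iotaV R A) (.var 0)))))
    | .comp A => .vlam (.comp A)
        (.llam .iunit (.ilet .svar (.lapp (iotaCinv R A) (.var 0))))
    | .lin A B => .vlam (.lin A B)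
        (.llam (cpsC R (cpsC R A)) (.lapp (iotaCinv R B) (.lapp (.var 0) (.lapp (iotaC R A) .svar))))
  /-- The closed term `ι_A̲ : (A̲ᶜ)ᶜ ⊸ A̲` (Figure 7). -/
  def iotaC (R : CType) : CType → Tm
    | .base a => .llam (cpsC R (cpsC R (.base a))) .svar
    | .cunit => .llam (cpsC R (cpsC R .cunit)) .cunit
    | .cand A B => .llam (cpsC R (cpsC R (.cand A B)))
        (.cpair (.lapp (iotaC R A) (.cfst .svar)) (.lapp (iotaC R B) (.csnd .svar)))
    | .carr A B => .llam (cpsC R (cpsC R (.carr A B)))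
        (.clam A (.lapp (iotaC R B) (.capp .svar (.vapp (iotaVinv R A) (.var 0)))))
    | .iunit => .llam (cpsC R (cpsC R .iunit)) .svar
    | .bang A => .llam (cpsC R (cpsC R (.bang A)))
        (.copowlet .svar (.ilet .svar (.bang (.vapp (iotaV R A) (.var 0)))))
    | .copow A B => .llam (cpsC R (cpsC R (.copow A B)))
        (.copowlet .svar (.copow (.vapp (iotaV R A) (.var 0)) (.lapp (iotaC R B) .svar)))
    | .czero => .llam (cpsC R (cpsC R .czero)) .svar
    | .csum A B => .llam (cpsC R (cpsC R (.csum A B)))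
        (.ccase .svar (.cinl (.lapp (iotaC R A) .svar)) (.cinr (.lapp (iotaC R B) .svar)))
  /-- The closed term `ι_A̲⁻¹ : A̲ ⊸ (A̲ᶜ)ᶜ`. -/
  def iotaCinv (R : CType) : CType → Tm
    | .base a => .llam (.base a) .svar
    | .cunit => .llam .cunit .cunit
    | .cand A B => .llam (.cand A B)
        (.cpair (.lapp (iotaCinv R A) (.cfst .svar)) (.lapp (iotaCinv R B) (.csnd .svar)))
    | .carr A B => .llam (.carr A B)
        (.clam (cpsV R (cpsV R A)) (.lapp (iotaCinv R B) (.capp .svar (.vapp (iotaV R A) (.var 0)))))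
    | .iunit => .llam .iunit .svar
    | .bang A => .llam (.bang A)
        (.banglet .svar (.copow (.vapp (iotaVinv R A) (.var 0)) .top))
    | .copow A B => .llam (.copow A B)
        (.copowlet .svar (.copow (.vapp (iotaVinv R A) (.var 0)) (.lapp (iotaCinv R B) .svar)))
    | .czero => .llam .czero .svar
    | .csum A B => .llam (.csum A B)
        (.ccase .svar (.cinl (.lapp (iotaCinv R A) .svar)) (.cinr (.lapp (iotaCinv R B) .svar)))
end

/-- The substitution `[ι⁻¹(Γ)]`, replacing each variable `xᵢ : Cᵢ` of `Γ` by
`ι_{Cᵢ}⁻¹(xᵢ)`. -/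
def iotaSubst (R : CType) (Γ : List VType) (t : Tm) : Tm :=
  Tm.psubst (fun n =>
    match Γ[n]? with
    | some C => .vapp (iotaVinv R C) (.var n)
    | none => .var n) t

/-! ## The simply-typed λ-calculus -/

/-- Simple types. -/
inductive STy : Type
  | base : ℕ → STy
  | unit : STy
  | prod : STy → STy → STy
  | arr : STy → STy → STy

/-- Raw simply-typed λ-terms (de Bruijn indices). -/
inductive LTm : Type
  | var : ℕ → LTm
  | unit : LTm
  | pair : LTm → LTm → LTm
  | fst : LTm → LTm
  | snd : LTm → LTm
  | lam : STy → LTm → LTm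
  | app : LTm → LTm → LTm

namespace LTm

/-- Renaming of variables. -/
def rename (f : ℕ → ℕ) : LTm → LTm
  | .var n => .var (f n)
  | .unit => .unit
  | .pair M N => .pair (rename f M) (rename f N)
  | .fst M => .fst (rename f M)
  | .snd M => .snd (rename f M)
  | .lam σ M => .lam σ (rename (Tm.liftN f) M)
  | .app M N => .app (rename f M) (rename f N)

/-- Weakening. -/
def shift (M : LTm) : LTm := rename Nat.succ M

/-- Parallel capture-avoiding substitution. -/
def psubst (σ : ℕ → LTm) : LTm → LTm
  | .var n => σ n
  | .unit => .unit
  | .pair M N => .pair (psubst σ M) (psubst σ N)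
  | .fst M => .fst (psubst σ M)
  | .snd M => .snd (psubst σ M)
  | .lam τ M => .lam τ (psubst (fun n => match n with | 0 => .var 0 | m + 1 => shift (σ m)) M)
  | .app M N => .app (psubst σ M) (psubst σ N)

/-- Capture-avoiding substitution `M[N/x]` for the innermost variable. -/
def subst0 (N : LTm) (M : LTm) : LTm :=
  psubst (fun n => match n with | 0 => N | m + 1 => .var m) M

end LTm

/-- Typing derivations of the simply-typed λ-calculus (Figure 3). -/
inductive LDeriv : List STy → LTm → STy → Type
  | var (Θ : List STy) (n : ℕ) (σ : STy) : Θ[n]? = some σ → LDeriv Θ (.var n) σ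
  | unit (Θ : List STy) : LDeriv Θ .unit .unit
  | pair (Θ : List STy) (M N : LTm) (σ τ : STy) :
      LDeriv Θ M σ → LDeriv Θ N τ → LDeriv Θ (.pair M N) (.prod σ τ)
  | fst (Θ : List STy) (M : LTm) (σ τ : STy) :
      LDeriv Θ M (.prod σ τ) → LDeriv Θ (.fst M) σ
  | snd (Θ : List STy) (M : LTm) (σ τ : STy) :
      LDeriv Θ M (.prod σ τ) → LDeriv Θ (.snd M) τ
  | lam (Θ : List STy) (M : LTm) (σ τ : STy) :
      LDeriv (σ :: Θ) M τ → LDeriv Θ (.lam σ M) (.arr σ τ)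
  | app (Θ : List STy) (M N : LTm) (σ τ : STy) :
      LDeriv Θ M (.arr σ τ) → LDeriv Θ N σ → LDeriv Θ (.app M N) τ

/-- Values of the (call-by-value) λ-calculus. -/
inductive LVal : LTm → Prop
  | var (n : ℕ) : LVal (.var n)
  | unit : LVal .unit
  | lam (σ : STy) (M : LTm) : LVal (.lam σ M)
  | pair {M N : LTm} : LVal M → LVal N → LVal (.pair M N)

/-- βη-equality of the simply-typed λ-calculus. -/
inductive LBetaEta : List STy → LTm → LTm → STy → Prop
  | refl {Θ M σ} : LDeriv Θ M σ → LBetaEta Θ M M σ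
  | symm {Θ M N σ} : LBetaEta Θ M N σ → LBetaEta Θ N M σ
  | trans {Θ M N P σ} : LBetaEta Θ M N σ → LBetaEta Θ N P σ → LBetaEta Θ M P σ
  | pair_cong {Θ M M' N N' σ τ} : LBetaEta Θ M M' σ → LBetaEta Θ N N' τ →
      LBetaEta Θ (.pair M N) (.pair M' N') (.prod σ τ)
  | fst_cong {Θ M M' σ τ} : LBetaEta Θ M M' (.prod σ τ) → LBetaEta Θ (.fst M) (.fst M') σ
  | snd_cong {Θ M M' σ τ} : LBetaEta Θ M M' (.prod σ τ) → LBetaEta Θ (.snd M) (.snd M') τ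
  | lam_cong {Θ M M' σ τ} : LBetaEta (σ :: Θ) M M' τ →
      LBetaEta Θ (.lam σ M) (.lam σ M') (.arr σ τ)
  | app_cong {Θ M M' N N' σ τ} : LBetaEta Θ M M' (.arr σ τ) → LBetaEta Θ N N' σ →
      LBetaEta Θ (.app M N) (.app M' N') τ
  | beta {Θ M N σ τ} : LDeriv (σ :: Θ) M τ → LDeriv Θ N σ →
      LBetaEta Θ (.app (.lam σ M) N) (LTm.subst0 N M) τ
  | eta {Θ M σ τ} : LDeriv Θ M (.arr σ τ) →
      LBetaEta Θ (.lam σ (.app (LTm.shift M) (.var 0))) M (.arr σ τ)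
  | fst_beta {Θ M N σ τ} : LDeriv Θ M σ → LDeriv Θ N τ →
      LBetaEta Θ (.fst (.pair M N)) M σ
  | snd_beta {Θ M N σ τ} : LDeriv Θ M σ → LDeriv Θ N τ →
      LBetaEta Θ (.snd (.pair M N)) N τ
  | pair_eta {Θ M σ τ} : LDeriv Θ M (.prod σ τ) →
      LBetaEta Θ (.pair (.fst M) (.snd M)) M (.prod σ τ)
  | unit_eta {Θ M} : LDeriv Θ M .unit → LBetaEta Θ M .unit .unit

/-- Equality in Moggi's computational λ-calculus `λc` (call-by-value
βη-equalities restricted to values, together with the `let`-laws, expressed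
via the standard encoding `let x = M in N := (λx.N) M`). -/
inductive LamC : List STy → LTm → LTm → STy → Prop
  | refl {Θ M σ} : LDeriv Θ M σ → LamC Θ M M σ
  | symm {Θ M N σ} : LamC Θ M N σ → LamC Θ N M σ
  | trans {Θ M N P σ} : LamC Θ M N σ → LamC Θ N P σ → LamC Θ M P σ
  | pair_cong {Θ M M' N N' σ τ} : LamC Θ M M' σ → LamC Θ N N' τ →
      LamC Θ (.pair M N) (.pair M' N') (.prod σ τ)
  | fst_cong {Θ M M' σ τ} : LamC Θ M M' (.prod σ τ) → LamC Θ (.fst M) (.fst M') σ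
  | snd_cong {Θ M M' σ τ} : LamC Θ M M' (.prod σ τ) → LamC Θ (.snd M) (.snd M') τ
  | lam_cong {Θ M M' σ τ} : LamC (σ :: Θ) M M' τ →
      LamC Θ (.lam σ M) (.lam σ M') (.arr σ τ)
  | app_cong {Θ M M' N N' σ τ} : LamC Θ M M' (.arr σ τ) → LamC Θ N N' σ →
      LamC Θ (.app M N) (.app M' N') τ
  | beta_v {Θ M V σ τ} : LDeriv (σ :: Θ) M τ → LDeriv Θ V σ → LVal V →
      LamC Θ (.app (.lam σ M) V) (LTm.subst0 V M) τ
  | eta_v {Θ V σ τ} : LVal V → LDeriv Θ V (.arr σ τ) →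
      LamC Θ (.lam σ (.app (LTm.shift V) (.var 0))) V (.arr σ τ)
  | fst_beta_v {Θ V W σ τ} : LVal V → LVal W → LDeriv Θ V σ → LDeriv Θ W τ →
      LamC Θ (.fst (.pair V W)) V σ
  | snd_beta_v {Θ V W σ τ} : LVal V → LVal W → LDeriv Θ V σ → LDeriv Θ W τ →
      LamC Θ (.snd (.pair V W)) W τ
  | pair_eta_v {Θ V σ τ} : LVal V → LDeriv Θ V (.prod σ τ) →
      LamC Θ (.pair (.fst V) (.snd V)) V (.prod σ τ)
  | unit_eta_v {Θ V} : LVal V → LDeriv Θ V .unit → LamC Θ V .unit .unit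
  | let_eta {Θ M σ} : LDeriv Θ M σ → LamC Θ (.app (.lam σ (.var 0)) M) M σ
  | let_assoc {Θ M N L σ ρ τ} : LDeriv (σ :: Θ) M τ → LDeriv (ρ :: Θ) N σ →
      LDeriv Θ L ρ →
      LamC Θ (.app (.lam σ M) (.app (.lam ρ N) L))
        (.app (.lam ρ (.app (.lam σ (LTm.rename (Tm.liftN Nat.succ) M)) N)) L) τ
  | app_left {Θ M N σ τ} : LDeriv Θ M (.arr σ τ) → LDeriv Θ N σ →
      LamC Θ (.app M N) (.app (.lam (.arr σ τ) (.app (.var 0) (LTm.shift N))) M) τ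
  | app_right {Θ V N σ τ} : LVal V → LDeriv Θ V (.arr σ τ) → LDeriv Θ N σ →
      LamC Θ (.app V N) (.app (.lam σ (.app (LTm.shift V) (.var 0))) N) τ
  | pair_left {Θ M N σ τ} : LDeriv Θ M σ → LDeriv Θ N τ →
      LamC Θ (.pair M N) (.app (.lam σ (.pair (.var 0) (LTm.shift N))) M) (.prod σ τ)
  | pair_right {Θ V N σ τ} : LVal V → LDeriv Θ V σ → LDeriv Θ N τ →
      LamC Θ (.pair V N) (.app (.lam τ (.pair (LTm.shift V) (.var 0))) N) (.prod σ τ)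
  | fst_cc {Θ M σ τ} : LDeriv Θ M (.prod σ τ) →
      LamC Θ (.fst M) (.app (.lam (.prod σ τ) (.fst (.var 0))) M) σ
  | snd_cc {Θ M σ τ} : LDeriv Θ M (.prod σ τ) →
      LamC Θ (.snd M) (.app (.lam (.prod σ τ) (.snd (.var 0))) M) τ

end EEC

namespace EEC

/-! ## The standard cbv and cbn translations of typed λ-calculus into EEC -/

/-- The computation-type constant `α̲` associated with a simply-typed
λ-calculus type constant `α` (the association is injective but not
surjective, so that some computation-type constants of EEC are different
from `α̲` for every λ-calculus type constant `α`). -/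
def assocC (a : ℕ) : CType := .base (a + 1)

/-- The call-by-value translation `σᵛ` on types. -/
def cbvT : STy → VType
  | .base a => .base a
  | .unit => .unit
  | .prod σ τ => .prod (cbvT σ) (cbvT τ)
  | .arr σ τ => .arr (cbvT σ) (.comp (.bang (cbvT τ)))

/-- The call-by-value translation `Θᵛ` on contexts. -/
def cbvCtx (Θ : List STy) : List VType := Θ.map cbvT

/-- The call-by-value translation on terms: `Θ ⊢ M : τ` is sent to
`Θᵛ ⊢ Mᵛ : !(τᵛ)`. -/
def cbvTm : LTm → Tm
  | .var n => .bang (.var n)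
  | .unit => .bang .unit
  | .pair M N => .banglet (cbvTm M) (.banglet (Tm.shift (cbvTm N)) (.bang (.vpair (.var 1) (.var 0))))
  | .fst M => .banglet (cbvTm M) (.bang (.vfst (.var 0)))
  | .snd M => .banglet (cbvTm M) (.bang (.vsnd (.var 0)))
  | .lam σ M => .bang (.vlam (cbvT σ) (cbvTm M))
  | .app M N => .banglet (cbvTm M) (.banglet (Tm.shift (cbvTm N)) (.vapp (.var 1) (.var 0)))

/-- The call-by-name translation `σⁿ` on types. -/
def cbnT : STy → CType
  | .base a => assocC a
  | .unit => .cunit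
  | .prod σ τ => .cand (cbnT σ) (cbnT τ)
  | .arr σ τ => .carr (.comp (cbnT σ)) (cbnT τ)

/-- The call-by-name translation `Θⁿ` on contexts. -/
def cbnCtx (Θ : List STy) : List VType := Θ.map (fun σ => .comp (cbnT σ))

/-- The call-by-name translation on terms: `Θ ⊢ M : τ` is sent to
`Θⁿ ⊢ Mⁿ : τⁿ`, mimicking each construct by the corresponding
computation-type construct of EEC. -/
def cbnTm : LTm → Tm
  | .var n => .var n
  | .unit => .cunit
  | .pair M N => .cpair (cbnTm M) (cbnTm N)
  | .fst M => .cfst (cbnTm M)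
  | .snd M => .csnd (cbnTm M)
  | .lam σ M => .clam (.comp (cbnT σ)) (cbnTm M)
  | .app M N => .capp (cbnTm M) (cbnTm N)

/-! ## Hasegawa's linear-use CPS translations (Section 4) -/

/-- The call-by-value linear-use CPS translation `σᵛᶜ` on types. -/
def cbvcpsT (R : CType) : STy → VType
  | .base a => .base a
  | .unit => .unit
  | .prod σ τ => .prod (cbvcpsT R σ) (cbvcpsT R τ)
  | .arr σ τ => .arr (cbvcpsT R σ) (.lin (.carr (cbvcpsT R τ) R) R)

/-- `Θᵛᶜ`. -/
def cbvcpsCtx (R : CType) (Θ : List STy) : List VType := Θ.map (cbvcpsT R)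

/-- The call-by-value linear-use CPS translation on terms: `Θ ⊢ M : τ` is
sent to `Θᵛᶜ ⊢ Mᵛᶜ : (τᵛᶜ ⇒ R̲) ⊸ R̲`. -/
def cbvcps (R : CType) : {Θ : List STy} → {M : LTm} → {σ : STy} → LDeriv Θ M σ → Tm
  | _, _, _, .var _ n σ _ => .llam (.carr (cbvcpsT R σ) R) (.capp .svar (.var n))
  | _, _, _, .unit _ => .llam (.carr .unit R) (.capp .svar .unit)
  | _, _, _, .pair _ _ _ σ τ dM dN =>
      .llam (.carr (.prod (cbvcpsT R σ) (cbvcpsT R τ)) R)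
        (.lapp (cbvcps R dM)
          (.clam (cbvcpsT R σ)
            (.lapp (Tm.shift (cbvcps R dN))
              (.clam (cbvcpsT R τ) (.capp .svar (.vpair (.var 1) (.var 0)))))))
  | _, _, _, .fst _ _ σ τ dM =>
      .llam (.carr (cbvcpsT R σ) R)
        (.lapp (cbvcps R dM)
          (.clam (.prod (cbvcpsT R σ) (cbvcpsT R τ)) (.capp .svar (.vfst (.var 0)))))
  | _, _, _, .snd _ _ σ τ dM =>
      .llam (.carr (cbvcpsT R τ) R)
        (.lapp (cbvcps R dM)
          (.clam (.prod (cbvcpsT R σ) (cbvcpsT R τ)) (.capp .svar (.vsnd (.var 0)))))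
  | _, _, _, .lam _ _ σ τ dM =>
      .llam (.carr (.arr (cbvcpsT R σ) (.lin (.carr (cbvcpsT R τ) R) R)) R)
        (.capp .svar (.vlam (cbvcpsT R σ) (cbvcps R dM)))
  | _, _, _, .app _ _ _ σ τ dM dN =>
      .llam (.carr (cbvcpsT R τ) R)
        (.lapp (cbvcps R dM)
          (.clam (.arr (cbvcpsT R σ) (.lin (.carr (cbvcpsT R τ) R) R))
            (.lapp (Tm.shift (cbvcps R dN))
              (.clam (cbvcpsT R σ) (.lapp (.vapp (.var 1) (.var 0)) .svar)))))

/-- The call-by-name linear-use CPS translation `σⁿᶜ` on types. -/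
def cbncpsT (R : CType) : STy → CType
  | .base a => assocC a
  | .unit => .czero
  | .prod σ τ => .csum (cbncpsT R σ) (cbncpsT R τ)
  | .arr σ τ => .copow (.lin (cbncpsT R σ) R) (cbncpsT R τ)

/-- `Θⁿᶜ ⊸ R̲`, assigning each variable `xᵢ : σᵢ` the type `σᵢⁿᶜ ⊸ R̲`. -/
def cbncpsCtx (R : CType) (Θ : List STy) : List VType :=
  Θ.map (fun σ => .lin (cbncpsT R σ) R)

/-- The call-by-name linear-use CPS translation on terms: `Θ ⊢ M : τ` is
sent to `Θⁿᶜ ⊸ R̲ ⊢ Mⁿᶜ : τⁿᶜ ⊸ R̲`. -/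
def cbncps (R : CType) : {Θ : List STy} → {M : LTm} → {σ : STy} → LDeriv Θ M σ → Tm
  | _, _, _, .var _ n _ _ => .var n
  | _, _, _, .unit _ => .llam .czero (.cimage R .svar)
  | _, _, _, .pair _ _ _ σ τ dM dN =>
      .llam (.csum (cbncpsT R σ) (cbncpsT R τ))
        (.ccase .svar (.lapp (cbncps R dM) .svar) (.lapp (cbncps R dN) .svar))
  | _, _, _, .fst _ _ σ _τ dM => .llam (cbncpsT R σ) (.lapp (cbncps R dM) (.cinl .svar))
  | _, _, _, .snd _ _ _ τ dM => .llam (cbncpsT R τ) (.lapp (cbncps R dM) (.cinr .svar))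
  | _, _, _, .lam _ _ σ τ dM =>
      .llam (.copow (.lin (cbncpsT R σ) R) (cbncpsT R τ))
        (.copowlet .svar (.lapp (cbncps R dM) .svar))
  | _, _, _, .app _ _ _ σ τ dM dN =>
      .llam (cbncpsT R τ) (.lapp (cbncps R dM) (.copow (cbncps R dN) .svar))

end EEC

namespace EEC

/-! ### Renaming and substitution on raw EEC terms -/

namespace Tm

theorem liftN_comp (f g : ℕ → ℕ) : liftN (f ∘ g) = liftN f ∘ liftN g := by
  funext n; cases n <;> rfl

theorem rename_rename (f g : ℕ → ℕ) (t : Tm) :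
    rename f (rename g t) = rename (f ∘ g) t := by
  induction t generalizing f g <;> simp_all [rename, liftN_comp]

theorem rename_shift (f : ℕ → ℕ) (t : Tm) :
    rename (liftN f) (shift t) = shift (rename f t) := by
  simp only [shift, rename_rename]
  rfl

theorem liftS_comp_liftN (σ : ℕ → Tm) (f : ℕ → ℕ) :
    liftS (σ ∘ f) = liftS σ ∘ liftN f := by
  funext n; cases n <;> rfl

theorem psubst_rename (σ : ℕ → Tm) (f : ℕ → ℕ) (t : Tm) :
    psubst σ (rename f t) = psubst (σ ∘ f) t := by
  induction t generalizing σ f <;> simp_all [rename, psubst, liftS_comp_liftN]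

theorem liftS_rename_comp (f : ℕ → ℕ) (σ : ℕ → Tm) :
    liftS (rename f ∘ σ) = rename (liftN f) ∘ liftS σ := by
  funext n
  cases n with
  | zero => rfl
  | succ n => exact (rename_shift f (σ n)).symm

theorem rename_psubst (f : ℕ → ℕ) (σ : ℕ → Tm) (t : Tm) :
    rename f (psubst σ t) = psubst (rename f ∘ σ) t := by
  induction t generalizing σ f <;> simp_all [rename, psubst, liftS_rename_comp]

theorem liftS_var : liftS var = var := by
  funext n; cases n <;> rfl

theorem psubst_var (t : Tm) : psubst var t = t := by
  induction t <;> simp_all [psubst, liftS_var]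

theorem psubst_liftS_shift (σ : ℕ → Tm) (t : Tm) :
    psubst (liftS σ) (shift t) = shift (psubst σ t) := by
  simp only [shift, psubst_rename, rename_psubst]
  rfl

theorem subst0_shift (u t : Tm) : subst0 u (shift t) = t := by
  simp only [subst0, shift, psubst_rename]
  exact psubst_var t

theorem rename_subst0 (f : ℕ → ℕ) (u t : Tm) :
    rename f (subst0 u t) = subst0 (rename f u) (rename (liftN f) t) := by
  simp only [subst0, psubst_rename, rename_psubst]
  congr 1
  funext n; cases n <;> rfl

theorem rename_ssubst (f : ℕ → ℕ) (u t : Tm) :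
    rename f (ssubst u t) = ssubst (rename f u) (rename f t) := by
  induction t generalizing u f <;> simp_all [rename, ssubst, rename_shift]

theorem subst0_var_zero_rename (t : Tm) :
    subst0 (var 0) (rename (liftN Nat.succ) t) = t := by
  simp only [subst0, psubst_rename]
  refine Eq.trans ?_ (psubst_var t)
  congr 1
  funext n; cases n <;> rfl

/-- The parallel substitution sending the innermost variable to `u`. -/
def scons (u : Tm) : ℕ → Tm
  | 0 => u
  | n + 1 => .var n

theorem subst0_eq (u t : Tm) : subst0 u t = psubst (scons u) t := by
  simp only [subst0]
  congr 1

theorem psubst_scons_shift (u t : Tm) : psubst (scons u) (shift t) = t := by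
  rw [← subst0_eq, subst0_shift]

end Tm

/-! ### Typed renamings -/

/-- `f` maps the variables of the context `Γ` to variables of `Γ'` of the same type. -/
def RenTyped {α : Type} (f : ℕ → ℕ) (Γ Γ' : List α) : Prop :=
  ∀ n A, Γ[n]? = some A → Γ'[f n]? = some A

theorem RenTyped.lift {α : Type} {f : ℕ → ℕ} {Γ Γ' : List α} (hf : RenTyped f Γ Γ') (A : α) :
    RenTyped (Tm.liftN f) (A :: Γ) (A :: Γ')
  | 0, _, h => h
  | n + 1, B, h => hf n B h

theorem RenTyped.succ {α : Type} (Γ : List α) (A : α) : RenTyped Nat.succ Γ (A :: Γ) :=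
  fun _ _ h => h

/-- Typing is stable under renaming. -/
def Deriv.rename {Γ Γ' : List VType} {Δ : Option CType} {t : Tm} {A : VType} {f : ℕ → ℕ} :
    Deriv Γ Δ t A → RenTyped f Γ Γ' → Deriv Γ' Δ (t.rename f) A
  | .var _ n A h, hf => .var _ _ _ (hf n A h)
  | .svar _ _, _ => .svar _ _
  | .unit _, _ => .unit _
  | .vpair _ _ _ _ _ d e, hf => .vpair _ _ _ _ _ (d.rename hf) (e.rename hf)
  | .vfst _ _ _ _ d, hf => .vfst _ _ _ _ (d.rename hf)
  | .vsnd _ _ _ _ d, hf => .vsnd _ _ _ _ (d.rename hf)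
  | .vlam _ _ _ _ d, hf => .vlam _ _ _ _ (d.rename (hf.lift _))
  | .vapp _ _ _ _ _ d e, hf => .vapp _ _ _ _ _ (d.rename hf) (e.rename hf)
  | .cunit _ _, _ => .cunit _ _
  | .cpair _ _ _ _ _ _ d e, hf => .cpair _ _ _ _ _ _ (d.rename hf) (e.rename hf)
  | .cfst _ _ _ _ _ d, hf => .cfst _ _ _ _ _ (d.rename hf)
  | .csnd _ _ _ _ _ d, hf => .csnd _ _ _ _ _ (d.rename hf)
  | .clam _ _ _ _ _ d, hf => .clam _ _ _ _ _ (d.rename (hf.lift _))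
  | .capp _ _ _ _ _ _ d e, hf => .capp _ _ _ _ _ _ (d.rename hf) (e.rename hf)
  | .top _, _ => .top _
  | .ilet _ _ _ _ _ d e, hf => .ilet _ _ _ _ _ (d.rename hf) (e.rename hf)
  | .bang _ _ _ d, hf => .bang _ _ _ (d.rename hf)
  | .banglet _ _ _ _ _ _ d e, hf => .banglet _ _ _ _ _ _ (d.rename hf) (e.rename (hf.lift _))
  | .copow _ _ _ _ _ _ d e, hf => .copow _ _ _ _ _ _ (d.rename hf) (e.rename hf)
  | .copowlet _ _ _ _ _ _ _ d e, hf =>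
      .copowlet _ _ _ _ _ _ _ (d.rename hf) (e.rename (hf.lift _))
  | .cimage _ _ _ _ d, hf => .cimage _ _ _ _ (d.rename hf)
  | .cinl _ _ _ _ _ d, hf => .cinl _ _ _ _ _ (d.rename hf)
  | .cinr _ _ _ _ _ d, hf => .cinr _ _ _ _ _ (d.rename hf)
  | .ccase _ _ _ _ _ _ _ _ d e e', hf =>
      .ccase _ _ _ _ _ _ _ _ (d.rename hf) (e.rename hf) (e'.rename hf)
  | .llam _ _ _ _ d, hf => .llam _ _ _ _ (d.rename hf)
  | .lapp _ _ _ _ _ _ d e, hf => .lapp _ _ _ _ _ _ (d.rename hf) (e.rename hf)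

/-- Weakening of typing derivations. -/
def Deriv.shift {Γ : List VType} {Δ : Option CType} {t : Tm} {A : VType}
    (d : Deriv Γ Δ t A) (B : VType) : Deriv (B :: Γ) Δ t.shift A :=
  d.rename (RenTyped.succ Γ B)

/-- A term typed in the empty stoup does not mention the stoup variable. -/
theorem Deriv.ssubst_eq {Γ : List VType} {Δ : Option CType} {t : Tm} {A : VType}
    (d : Deriv Γ Δ t A) (hΔ : Δ = none) (u : Tm) : Tm.ssubst u t = t := by
  induction d generalizing u <;> simp_all [Tm.ssubst]

/-- The equational theory is stable under renaming. -/
theorem EEq.rename {Γ Γ' : List VType} {Δ : Option CType} {t u : Tm} {A : VType} {f : ℕ → ℕ}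
    (h : EEq Γ Δ t u A) (hf : RenTyped f Γ Γ') : EEq Γ' Δ (t.rename f) (u.rename f) A := by
  induction h generalizing Γ' f with
  | refl d => exact .refl (d.rename hf)
  | symm _ ih => exact .symm (ih hf)
  | trans _ _ ih₁ ih₂ => exact .trans (ih₁ hf) (ih₂ hf)
  | vpair_cong _ _ ih₁ ih₂ => exact .vpair_cong (ih₁ hf) (ih₂ hf)
  | vfst_cong _ ih => exact .vfst_cong (ih hf)
  | vsnd_cong _ ih => exact .vsnd_cong (ih hf)
  | vlam_cong _ ih => exact .vlam_cong (ih (hf.lift _))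
  | vapp_cong _ _ ih₁ ih₂ => exact .vapp_cong (ih₁ hf) (ih₂ hf)
  | cpair_cong _ _ ih₁ ih₂ => exact .cpair_cong (ih₁ hf) (ih₂ hf)
  | cfst_cong _ ih => exact .cfst_cong (ih hf)
  | csnd_cong _ ih => exact .csnd_cong (ih hf)
  | clam_cong _ ih => exact .clam_cong (ih (hf.lift _))
  | capp_cong _ _ ih₁ ih₂ => exact .capp_cong (ih₁ hf) (ih₂ hf)
  | ilet_cong _ _ ih₁ ih₂ => exact .ilet_cong (ih₁ hf) (ih₂ hf)
  | bang_cong _ ih => exact .bang_cong (ih hf)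
  | banglet_cong _ _ ih₁ ih₂ => exact .banglet_cong (ih₁ hf) (ih₂ (hf.lift _))
  | copow_cong _ _ ih₁ ih₂ => exact .copow_cong (ih₁ hf) (ih₂ hf)
  | copowlet_cong _ _ ih₁ ih₂ => exact .copowlet_cong (ih₁ hf) (ih₂ (hf.lift _))
  | cimage_cong _ ih => exact .cimage_cong (ih hf)
  | cinl_cong _ ih => exact .cinl_cong (ih hf)
  | cinr_cong _ ih => exact .cinr_cong (ih hf)
  | ccase_cong _ _ _ ih₁ ih₂ ih₃ => exact .ccase_cong (ih₁ hf) (ih₂ hf) (ih₃ hf)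
  | llam_cong _ ih => exact .llam_cong (ih hf)
  | lapp_cong _ _ ih₁ ih₂ => exact .lapp_cong (ih₁ hf) (ih₂ hf)
  | unit_eta d => exact .unit_eta (d.rename hf)
  | vfst_beta d e => exact .vfst_beta (d.rename hf) (e.rename hf)
  | vsnd_beta d e => exact .vsnd_beta (d.rename hf) (e.rename hf)
  | vpair_eta d => exact .vpair_eta (d.rename hf)
  | vlam_beta d e =>
      rw [Tm.rename_subst0]
      exact .vlam_beta (d.rename (hf.lift _)) (e.rename hf)
  | vlam_eta d =>
      have := EEq.vlam_eta (d.rename hf)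
      rwa [← Tm.rename_shift] at this
  | cunit_eta d => exact .cunit_eta (d.rename hf)
  | cfst_beta d e => exact .cfst_beta (d.rename hf) (e.rename hf)
  | csnd_beta d e => exact .csnd_beta (d.rename hf) (e.rename hf)
  | cpair_eta d => exact .cpair_eta (d.rename hf)
  | clam_beta d e =>
      rw [Tm.rename_subst0]
      exact .clam_beta (d.rename (hf.lift _)) (e.rename hf)
  | clam_eta d =>
      have := EEq.clam_eta (d.rename hf)
      rwa [← Tm.rename_shift] at this
  | ilet_beta d => exact .ilet_beta (d.rename hf)
  | ilet_eta d e =>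
      have := EEq.ilet_eta (d.rename hf) (e.rename hf)
      simpa only [Tm.rename, Tm.rename_ssubst] using this
  | bang_beta d e =>
      rw [Tm.rename_subst0]
      exact .bang_beta (d.rename hf) (e.rename (hf.lift _))
  | bang_eta d e =>
      have := EEq.bang_eta (d.rename hf) (e.rename hf)
      simpa only [Tm.rename, Tm.liftN, Tm.rename_ssubst, Tm.rename_shift] using this
  | copow_beta d e e' =>
      have := EEq.copow_beta (d.rename hf) (e.rename hf) (e'.rename (hf.lift _))
      simpa only [Tm.rename, Tm.rename_ssubst, Tm.rename_subst0] using this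
  | copow_eta d e =>
      have := EEq.copow_eta (d.rename hf) (e.rename hf)
      simpa only [Tm.rename, Tm.liftN, Tm.rename_ssubst, Tm.rename_shift] using this
  | czero_eta d e =>
      have := EEq.czero_eta (d.rename hf) (e.rename hf)
      simpa only [Tm.rename, Tm.rename_ssubst] using this
  | csum_beta_inl d e e' =>
      have := EEq.csum_beta_inl (d.rename hf) (e.rename hf) (e'.rename hf)
      simpa only [Tm.rename, Tm.rename_ssubst] using this
  | csum_beta_inr d e e' =>
      have := EEq.csum_beta_inr (d.rename hf) (e.rename hf) (e'.rename hf)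
      simpa only [Tm.rename, Tm.rename_ssubst] using this
  | csum_eta d e =>
      have := EEq.csum_eta (d.rename hf) (e.rename hf)
      simpa only [Tm.rename, Tm.rename_ssubst] using this
  | llam_beta d e =>
      rw [Tm.rename_ssubst]
      exact .llam_beta (d.rename hf) (e.rename hf)
  | llam_eta d => exact .llam_eta (d.rename hf)

/-- Weakening of equations. -/
theorem EEq.shift {Γ : List VType} {Δ : Option CType} {t u : Tm} {A : VType}
    (h : EEq Γ Δ t u A) (B : VType) : EEq (B :: Γ) Δ t.shift u.shift A :=
  h.rename (RenTyped.succ Γ B)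

/-- Extensionality for the linear function space. -/
theorem EEq.llam_ext {Γ : List VType} {t u : Tm} {A B : CType}
    (dt : Deriv Γ none t (.lin A B)) (du : Deriv Γ none u (.lin A B))
    (h : EEq Γ (some A) (.lapp t .svar) (.lapp u .svar) (.comp B)) :
    EEq Γ none t u (.lin A B) :=
  (EEq.llam_eta dt).symm.trans (h.llam_cong.trans (.llam_eta du))

/-! ### Simply-typed derivations -/

theorem LDeriv.type_unique {Θ : List STy} {M : LTm} {σ τ : STy}
    (d : LDeriv Θ M σ) (e : LDeriv Θ M τ) : σ = τ := by
  induction d generalizing τ with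
  | var _ _ _ h => cases e with | var _ _ _ h' => exact Option.some.inj (h.symm.trans h')
  | unit => cases e; rfl
  | pair _ _ _ _ _ _ _ ih₁ ih₂ =>
      cases e with | pair _ _ _ _ _ e₁ e₂ => rw [ih₁ e₁, ih₂ e₂]
  | fst _ _ _ _ _ ih => cases e with | fst _ _ _ _ e => exact (STy.prod.inj (ih e)).1
  | snd _ _ _ _ _ ih => cases e with | snd _ _ _ _ e => exact (STy.prod.inj (ih e)).2
  | lam _ _ _ _ _ ih => cases e with | lam _ _ _ _ e => rw [ih e]
  | app _ _ _ _ _ _ _ ih₁ _ =>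
      cases e with | app _ _ _ _ _ e₁ _ => exact (STy.arr.inj (ih₁ e₁)).2

theorem LDeriv.eq {Θ : List STy} {M : LTm} {σ : STy} (d e : LDeriv Θ M σ) : d = e := by
  induction d with
  | var => cases e; rfl
  | unit => cases e; rfl
  | pair _ _ _ _ _ _ _ ih₁ ih₂ =>
      cases e with | pair _ _ _ _ _ e₁ e₂ => rw [ih₁ e₁, ih₂ e₂]
  | fst _ _ _ _ d ih =>
      cases e with | fst _ _ _ _ e => cases d.type_unique e; rw [ih e]
  | snd _ _ _ _ d ih =>
      cases e with | snd _ _ _ _ e => cases d.type_unique e; rw [ih e]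
  | lam _ _ _ _ _ ih => cases e with | lam _ _ _ _ e => rw [ih e]
  | app _ _ _ _ _ _ d ih₁ ih₂ =>
      cases e with | app _ _ _ _ _ e₁ e₂ => cases d.type_unique e₂; rw [ih₁ e₁, ih₂ e₂]

/-- Typing of the λ-calculus is stable under renaming. -/
def LDeriv.rename {Θ Θ' : List STy} {M : LTm} {σ : STy} {f : ℕ → ℕ} :
    LDeriv Θ M σ → RenTyped f Θ Θ' → LDeriv Θ' (M.rename f) σ
  | .var _ n σ h, hf => .var _ _ _ (hf n σ h)
  | .unit _, _ => .unit _
  | .pair _ _ _ _ _ d e, hf => .pair _ _ _ _ _ (d.rename hf) (e.rename hf)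
  | .fst _ _ _ _ d, hf => .fst _ _ _ _ (d.rename hf)
  | .snd _ _ _ _ d, hf => .snd _ _ _ _ (d.rename hf)
  | .lam _ _ _ _ d, hf => .lam _ _ _ _ (d.rename (hf.lift _))
  | .app _ _ _ _ _ d e, hf => .app _ _ _ _ _ (d.rename hf) (e.rename hf)

/-- Weakening of λ-calculus derivations. -/
def LDeriv.shift {Θ : List STy} {M : LTm} {σ : STy} (d : LDeriv Θ M σ) (ρ : STy) :
    LDeriv (ρ :: Θ) M.shift σ :=
  d.rename (RenTyped.succ Θ ρ)

/-- A family of derivations for the terms of a substitution from `Θ` to `Θ'`. -/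
def SubDeriv (s : ℕ → LTm) (Θ Θ' : List STy) : Type :=
  ∀ n σ, Θ[n]? = some σ → LDeriv Θ' (s n) σ

/-- The lifting of a typed substitution under a binder. -/
def SubDeriv.lift {s : ℕ → LTm} {Θ Θ' : List STy} (ds : SubDeriv s Θ Θ') (ρ : STy) :
    SubDeriv (fun n => match n with | 0 => .var 0 | m + 1 => (s m).shift) (ρ :: Θ) (ρ :: Θ')
  | 0, σ, h => .var _ 0 σ h
  | n + 1, σ, h => (ds n σ h).shift ρ

/-- The typed substitution replacing the innermost variable. -/
def SubDeriv.single {Θ : List STy} {N : LTm} {σ : STy} (d : LDeriv Θ N σ) :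
    SubDeriv (fun n => match n with | 0 => N | m + 1 => .var m) (σ :: Θ) Θ
  | 0, _, h => Option.some.inj h ▸ d
  | n + 1, τ, h => .var _ n τ h

/-- Typing of the λ-calculus is stable under substitution. -/
def LDeriv.psubst {Θ Θ' : List STy} {M : LTm} {σ : STy} {s : ℕ → LTm} :
    LDeriv Θ M σ → SubDeriv s Θ Θ' → LDeriv Θ' (M.psubst s) σ
  | .var _ n σ h, ds => ds n σ h
  | .unit _, _ => .unit _
  | .pair _ _ _ _ _ d e, ds => .pair _ _ _ _ _ (d.psubst ds) (e.psubst ds)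
  | .fst _ _ _ _ d, ds => .fst _ _ _ _ (d.psubst ds)
  | .snd _ _ _ _ d, ds => .snd _ _ _ _ (d.psubst ds)
  | .lam _ _ _ _ d, ds => .lam _ _ _ _ (d.psubst (ds.lift _))
  | .app _ _ _ _ _ d e, ds => .app _ _ _ _ _ (d.psubst ds) (e.psubst ds)

/-! ### The call-by-value linear-use CPS translation -/

/-- The type `τᵛᶜ ⇒ R̲` of continuations. -/
abbrev contT (R : CType) (τ : STy) : CType := .carr (cbvcpsT R τ) R

/-- Inversion for linear abstraction. -/
def Deriv.llam_inv {Γ : List VType} {t : Tm} {A B : CType} :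
    Deriv Γ none (.llam A t) (.lin A B) → Deriv Γ (some A) t (.comp B)
  | .llam _ _ _ _ d => d

/-- The CPS translation of a typed term is typed. -/
def cbvcps_deriv (R : CType) {Θ : List STy} {M : LTm} {σ : STy} :
    (d : LDeriv Θ M σ) → Deriv (cbvcpsCtx R Θ) none (cbvcps R d) (.lin (contT R σ) R)
  | .var _ n σ h =>
      .llam _ _ _ _ (.capp _ _ _ _ _ _ (.svar _ _)
        (.var _ _ _ (by simp only [cbvcpsCtx, List.getElem?_map, h, Option.map_some])))
  | .unit _ => .llam _ _ _ _ (.capp _ _ _ _ _ _ (.svar _ _) (.unit _))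
  | .pair _ _ _ σ τ d e =>
      .llam _ _ _ _ (.lapp _ _ _ _ _ _ (cbvcps_deriv R d) (.clam _ _ _ _ _
        (.lapp _ _ _ _ _ _ ((cbvcps_deriv R e).shift _) (.clam _ _ _ _ _
          (.capp _ _ _ _ (.prod (cbvcpsT R σ) (cbvcpsT R τ)) _ (.svar _ _)
            (.vpair _ _ _ _ _ (.var _ _ _ rfl) (.var _ _ _ rfl)))))))
  | .fst _ _ σ τ d =>
      .llam _ _ _ _ (.lapp _ _ _ _ _ _ (cbvcps_deriv R d) (.clam _ _ _ _ _
        (.capp _ _ _ _ _ _ (.svar _ _) (.vfst _ _ _ (cbvcpsT R τ) (.var _ _ _ rfl)))))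
  | .snd _ _ σ τ d =>
      .llam _ _ _ _ (.lapp _ _ _ _ _ _ (cbvcps_deriv R d) (.clam _ _ _ _ _
        (.capp _ _ _ _ _ _ (.svar _ _) (.vsnd _ _ (cbvcpsT R σ) _ (.var _ _ _ rfl)))))
  | .lam _ _ _ _ d =>
      .llam _ _ _ _ (.capp _ _ _ _ _ _ (.svar _ _) (.vlam _ _ _ _ (cbvcps_deriv R d)))
  | .app _ _ _ σ τ d e =>
      .llam _ _ _ _ (.lapp _ _ _ _ _ _ (cbvcps_deriv R d) (.clam _ _ _ _ _
        (.lapp _ _ _ _ _ _ ((cbvcps_deriv R e).shift _) (.clam _ _ _ _ _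
          (.lapp _ _ _ _ (contT R τ) _
            (.vapp _ _ _ (cbvcpsT R σ) _ (.var _ _ _ rfl) (.var _ _ _ rfl)) (.svar _ _))))))

theorem cbvcps_rename (R : CType) {Θ Θ' : List STy} {M : LTm} {σ : STy} {f : ℕ → ℕ}
    (d : LDeriv Θ M σ) (hf : RenTyped f Θ Θ') :
    cbvcps R (d.rename hf) = (cbvcps R d).rename f := by
  induction d generalizing Θ' f <;>
    simp_all [cbvcps, LDeriv.rename, Tm.rename, Tm.rename_shift, Tm.liftN]

theorem cbvcps_shift (R : CType) {Θ : List STy} {M : LTm} {σ : STy}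
    (d : LDeriv Θ M σ) (ρ : STy) : cbvcps R (d.shift ρ) = (cbvcps R d).shift :=
  cbvcps_rename R d _

theorem cbvcps_ssubst (R : CType) {Θ : List STy} {M : LTm} {σ : STy}
    (d : LDeriv Θ M σ) (u : Tm) : Tm.ssubst u (cbvcps R d) = cbvcps R d :=
  (cbvcps_deriv R d).ssubst_eq rfl u

theorem cbvcps_shift_ssubst (R : CType) {Θ : List STy} {M : LTm} {σ : STy}
    (d : LDeriv Θ M σ) (u : Tm) :
    Tm.ssubst u (cbvcps R d).shift = (cbvcps R d).shift :=
  ((cbvcps_deriv R d).shift .unit).ssubst_eq rfl u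

/-- The translation of `d` immediately passes the pure term `v` to its continuation. -/
def IsPure (R : CType) {Θ : List STy} {M : LTm} {σ : STy} (d : LDeriv Θ M σ) (v : Tm) : Prop :=
  Nonempty (Deriv (cbvcpsCtx R Θ) none v (cbvcpsT R σ)) ∧
    EEq (cbvcpsCtx R Θ) none (cbvcps R d) (.llam (contT R σ) (.capp .svar v))
      (.lin (contT R σ) R)

section

variable {R : CType} {Θ : List STy} {Δ : Option CType} {M N : LTm} {σ τ ρ : STy} {K v w : Tm}

theorem IsPure.lapp {dM : LDeriv Θ M σ} (p : IsPure R dM v)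
    (dK : Deriv (cbvcpsCtx R Θ) Δ K (.comp (contT R σ))) :
    EEq (cbvcpsCtx R Θ) Δ (.lapp (cbvcps R dM) K) (.capp K v) (.comp R) := by
  obtain ⟨⟨dv⟩, h⟩ := p
  refine (EEq.lapp_cong h (.refl dK)).trans ?_
  have := EEq.llam_beta (.capp _ _ _ _ _ _ (.svar _ _) dv) dK
  simpa only [Tm.ssubst, dv.ssubst_eq rfl] using this

/-- Two translations agree as soon as they agree on the generic continuation. -/
theorem cbvcps_ext (dM : LDeriv Θ M σ) (dN : LDeriv Θ N σ)
    (h : EEq (cbvcpsCtx R Θ) (some (contT R σ)) (.lapp (cbvcps R dM) .svar)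
      (.lapp (cbvcps R dN) .svar) (.comp R)) :
    EEq (cbvcpsCtx R Θ) none (cbvcps R dM) (cbvcps R dN) (.lin (contT R σ) R) :=
  .llam_ext (cbvcps_deriv R dM) (cbvcps_deriv R dN) h

theorem IsPure.of_lapp {dM : LDeriv Θ M σ}
    (dv : Deriv (cbvcpsCtx R Θ) none v (cbvcpsT R σ))
    (h : EEq (cbvcpsCtx R Θ) (some (contT R σ)) (.lapp (cbvcps R dM) .svar)
      (.capp .svar v) (.comp R)) : IsPure R dM v :=
  ⟨⟨dv⟩, (EEq.llam_eta (cbvcps_deriv R dM)).symm.trans h.llam_cong⟩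

theorem IsPure.congr {dM : LDeriv Θ M σ} (p : IsPure R dM v)
    (dw : Deriv (cbvcpsCtx R Θ) none w (cbvcpsT R σ))
    (h : EEq (cbvcpsCtx R Θ) none v w (cbvcpsT R σ)) : IsPure R dM w :=
  ⟨⟨dw⟩, p.2.trans (.llam_cong (.capp_cong (.refl (.svar _ _)) h))⟩

theorem IsPure.eq {dM : LDeriv Θ M σ} {dN : LDeriv Θ N σ} (p : IsPure R dM v)
    (q : IsPure R dN v) :
    EEq (cbvcpsCtx R Θ) none (cbvcps R dM) (cbvcps R dN) (.lin (contT R σ) R) :=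
  p.2.trans q.2.symm

theorem IsPure.shift {dM : LDeriv Θ M σ} (p : IsPure R dM v) (ρ : STy) :
    IsPure R (dM.shift ρ) v.shift := by
  obtain ⟨⟨dv⟩, h⟩ := p
  refine ⟨⟨dv.shift _⟩, ?_⟩
  rw [cbvcps_shift]
  exact h.shift (cbvcpsT R ρ)

theorem IsPure.var {n : ℕ} (h : Θ[n]? = some σ) : IsPure R (.var Θ n σ h) (.var n) :=
  have dv : Deriv (cbvcpsCtx R Θ) none (.var n) (cbvcpsT R σ) :=
    .var _ _ _ (by simp only [cbvcpsCtx, List.getElem?_map, h, Option.map_some])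
  ⟨⟨dv⟩, .refl (cbvcps_deriv R _)⟩

theorem IsPure.unit : IsPure R (.unit Θ) .unit :=
  ⟨⟨.unit _⟩, .refl (cbvcps_deriv R _)⟩

theorem IsPure.lam (d : LDeriv (σ :: Θ) M τ) :
    IsPure R (.lam Θ M σ τ d) (.vlam (cbvcpsT R σ) (cbvcps R d)) :=
  ⟨⟨.vlam _ _ _ _ (cbvcps_deriv R d)⟩, .refl (cbvcps_deriv R (.lam Θ M σ τ d))⟩

/-! ### Translations applied to a continuation -/

theorem cbvcps_pair_lapp (dM : LDeriv Θ M σ) (dN : LDeriv Θ N τ)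
    (dK : Deriv (cbvcpsCtx R Θ) Δ K (.comp (contT R (.prod σ τ)))) :
    EEq (cbvcpsCtx R Θ) Δ (.lapp (cbvcps R (.pair Θ M N σ τ dM dN)) K)
      (.lapp (cbvcps R dM) (.clam (cbvcpsT R σ) (.lapp (cbvcps R dN).shift
        (.clam (cbvcpsT R τ) (.capp K.shift.shift (.vpair (.var 1) (.var 0)))))))
      (.comp R) := by
  have := EEq.llam_beta (cbvcps_deriv R (.pair Θ M N σ τ dM dN)).llam_inv dK
  simpa only [cbvcps, Tm.ssubst, cbvcps_ssubst, cbvcps_shift_ssubst] using this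

theorem cbvcps_fst_lapp (dM : LDeriv Θ M (.prod σ τ))
    (dK : Deriv (cbvcpsCtx R Θ) Δ K (.comp (contT R σ))) :
    EEq (cbvcpsCtx R Θ) Δ (.lapp (cbvcps R (.fst Θ M σ τ dM)) K)
      (.lapp (cbvcps R dM)
        (.clam (cbvcpsT R (.prod σ τ)) (.capp K.shift (.vfst (.var 0)))))
      (.comp R) := by
  have := EEq.llam_beta (cbvcps_deriv R (.fst Θ M σ τ dM)).llam_inv dK
  simpa only [cbvcps, cbvcpsT, Tm.ssubst, cbvcps_ssubst] using this

theorem cbvcps_snd_lapp (dM : LDeriv Θ M (.prod σ τ))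
    (dK : Deriv (cbvcpsCtx R Θ) Δ K (.comp (contT R τ))) :
    EEq (cbvcpsCtx R Θ) Δ (.lapp (cbvcps R (.snd Θ M σ τ dM)) K)
      (.lapp (cbvcps R dM)
        (.clam (cbvcpsT R (.prod σ τ)) (.capp K.shift (.vsnd (.var 0)))))
      (.comp R) := by
  have := EEq.llam_beta (cbvcps_deriv R (.snd Θ M σ τ dM)).llam_inv dK
  simpa only [cbvcps, cbvcpsT, Tm.ssubst, cbvcps_ssubst] using this

theorem cbvcps_app_lapp (dM : LDeriv Θ M (.arr σ τ)) (dN : LDeriv Θ N σ)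
    (dK : Deriv (cbvcpsCtx R Θ) Δ K (.comp (contT R τ))) :
    EEq (cbvcpsCtx R Θ) Δ (.lapp (cbvcps R (.app Θ M N σ τ dM dN)) K)
      (.lapp (cbvcps R dM) (.clam (cbvcpsT R (.arr σ τ)) (.lapp (cbvcps R dN).shift
        (.clam (cbvcpsT R σ) (.lapp (.vapp (.var 1) (.var 0)) K.shift.shift)))))
      (.comp R) := by
  have := EEq.llam_beta (cbvcps_deriv R (.app Θ M N σ τ dM dN)).llam_inv dK
  simpa only [cbvcps, cbvcpsT, Tm.ssubst, cbvcps_ssubst, cbvcps_shift_ssubst] using this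

/-- Pairing with a pure first component. -/
theorem IsPure.pair_lapp {dM : LDeriv Θ M σ} (p : IsPure R dM v) (dN : LDeriv Θ N τ)
    (dK : Deriv (cbvcpsCtx R Θ) Δ K (.comp (contT R (.prod σ τ)))) :
    EEq (cbvcpsCtx R Θ) Δ (.lapp (cbvcps R (.pair Θ M N σ τ dM dN)) K)
      (.lapp (cbvcps R dN)
        (.clam (cbvcpsT R τ) (.capp K.shift (.vpair v.shift (.var 0)))))
      (.comp R) := by
  have body : Deriv (cbvcpsT R σ :: cbvcpsCtx R Θ) Δ (.lapp (cbvcps R dN).shift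
      (.clam (cbvcpsT R τ) (.capp K.shift.shift (.vpair (.var 1) (.var 0))))) (.comp R) :=
    .lapp _ _ _ _ _ _ ((cbvcps_deriv R dN).shift _) (.clam _ _ _ _ _
      (.capp _ _ _ _ _ _ ((dK.shift _).shift _)
        (.vpair _ _ _ _ _ (.var _ _ _ rfl) (.var _ _ _ rfl))))
  refine (cbvcps_pair_lapp dM dN dK).trans ((p.lapp (.clam _ _ _ _ _ body)).trans ?_)
  have := EEq.clam_beta body p.1.some
  simpa only [Tm.subst0_eq, Tm.psubst, Tm.psubst_liftS_shift, Tm.psubst_scons_shift,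
    Tm.liftS, Tm.scons] using this

/-- Projecting from a pure pair. -/
theorem IsPure.fst {dM : LDeriv Θ M (.prod σ τ)} (p : IsPure R dM v) :
    IsPure R (.fst Θ M σ τ dM) (.vfst v) := by
  have dv := p.1.some
  refine .of_lapp (.vfst _ _ _ (cbvcpsT R τ) dv) ?_
  have body : Deriv (cbvcpsT R (.prod σ τ) :: cbvcpsCtx R Θ) (some (contT R σ))
      (.capp .svar (.vfst (.var 0))) (.comp R) :=
    .capp _ _ _ _ _ _ (.svar _ _) (.vfst _ _ _ (cbvcpsT R τ) (.var _ _ _ rfl))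
  exact (cbvcps_fst_lapp dM (.svar _ _)).trans
    ((p.lapp (.clam _ _ _ _ _ body)).trans (EEq.clam_beta body dv))

theorem IsPure.snd {dM : LDeriv Θ M (.prod σ τ)} (p : IsPure R dM v) :
    IsPure R (.snd Θ M σ τ dM) (.vsnd v) := by
  have dv := p.1.some
  refine .of_lapp (.vsnd _ _ (cbvcpsT R σ) _ dv) ?_
  have body : Deriv (cbvcpsT R (.prod σ τ) :: cbvcpsCtx R Θ) (some (contT R τ))
      (.capp .svar (.vsnd (.var 0))) (.comp R) :=
    .capp _ _ _ _ _ _ (.svar _ _) (.vsnd _ _ (cbvcpsT R σ) _ (.var _ _ _ rfl))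
  exact (cbvcps_snd_lapp dM (.svar _ _)).trans
    ((p.lapp (.clam _ _ _ _ _ body)).trans (EEq.clam_beta body dv))

theorem IsPure.pair {dM : LDeriv Θ M σ} {dN : LDeriv Θ N τ} (p : IsPure R dM v)
    (q : IsPure R dN w) : IsPure R (.pair Θ M N σ τ dM dN) (.vpair v w) := by
  have dv := p.1.some
  have dw := q.1.some
  refine .of_lapp (.vpair _ _ _ _ _ dv dw) ?_
  have body : Deriv (cbvcpsT R τ :: cbvcpsCtx R Θ) (some (contT R (.prod σ τ)))
      (.capp .svar (.vpair v.shift (.var 0))) (.comp R) :=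
    .capp _ _ _ _ _ _ (.svar _ _) (.vpair _ _ _ _ _ (dv.shift _) (.var _ _ _ rfl))
  refine (p.pair_lapp dN (.svar _ _)).trans ((q.lapp (.clam _ _ _ _ _ body)).trans ?_)
  have := EEq.clam_beta body dw
  simpa only [Tm.subst0_eq, Tm.psubst, Tm.psubst_scons_shift, Tm.scons] using this

/-- Application of a pure function. -/
theorem IsPure.app_lapp {dM : LDeriv Θ M (.arr σ τ)} (p : IsPure R dM v) (dN : LDeriv Θ N σ)
    (dK : Deriv (cbvcpsCtx R Θ) Δ K (.comp (contT R τ))) :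
    EEq (cbvcpsCtx R Θ) Δ (.lapp (cbvcps R (.app Θ M N σ τ dM dN)) K)
      (.lapp (cbvcps R dN)
        (.clam (cbvcpsT R σ) (.lapp (.vapp v.shift (.var 0)) K.shift)))
      (.comp R) := by
  have body : Deriv (cbvcpsT R (.arr σ τ) :: cbvcpsCtx R Θ) Δ (.lapp (cbvcps R dN).shift
      (.clam (cbvcpsT R σ) (.lapp (.vapp (.var 1) (.var 0)) K.shift.shift))) (.comp R) :=
    .lapp _ _ _ _ _ _ ((cbvcps_deriv R dN).shift _) (.clam _ _ _ _ _
      (.lapp _ _ _ _ _ _ (.vapp _ _ _ _ _ (.var _ _ _ rfl) (.var _ _ _ rfl))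
        ((dK.shift _).shift _)))
  refine (cbvcps_app_lapp dM dN dK).trans ((p.lapp (.clam _ _ _ _ _ body)).trans ?_)
  have := EEq.clam_beta body p.1.some
  simpa only [Tm.subst0_eq, Tm.psubst, Tm.psubst_liftS_shift, Tm.psubst_scons_shift,
    Tm.liftS, Tm.scons] using this

/-- Application of a pure function to a pure argument. -/
theorem IsPure.app {dM : LDeriv Θ M (.arr σ τ)} {dN : LDeriv Θ N σ} (p : IsPure R dM v)
    (q : IsPure R dN w) :
    EEq (cbvcpsCtx R Θ) none (cbvcps R (.app Θ M N σ τ dM dN)) (.vapp v w)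
      (.lin (contT R τ) R) := by
  have dv := p.1.some
  have dw := q.1.some
  refine .llam_ext (cbvcps_deriv R _) (.vapp _ _ _ _ _ dv dw) ?_
  have body : Deriv (cbvcpsT R σ :: cbvcpsCtx R Θ) (some (contT R τ))
      (.lapp (.vapp v.shift (.var 0)) .svar) (.comp R) :=
    .lapp _ _ _ _ _ _ (.vapp _ _ _ _ _ (dv.shift _) (.var _ _ _ rfl)) (.svar _ _)
  refine (p.app_lapp dN (.svar _ _)).trans ((q.lapp (.clam _ _ _ _ _ body)).trans ?_)
  have := EEq.clam_beta body dw
  simpa only [Tm.subst0_eq, Tm.psubst, Tm.psubst_scons_shift, Tm.scons] using this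

/-- The translation of `let x = M in N`. -/
theorem cbvcps_let_lapp (dN : LDeriv (σ :: Θ) N τ) (dM : LDeriv Θ M σ)
    (dK : Deriv (cbvcpsCtx R Θ) Δ K (.comp (contT R τ))) :
    EEq (cbvcpsCtx R Θ) Δ
      (.lapp (cbvcps R (.app Θ (.lam σ N) M σ τ (.lam Θ N σ τ dN) dM)) K)
      (.lapp (cbvcps R dM) (.clam (cbvcpsT R σ) (.lapp (cbvcps R dN) K.shift)))
      (.comp R) := by
  refine ((IsPure.lam dN).app_lapp dM dK).trans
    (.lapp_cong (.refl (cbvcps_deriv R dM))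
      (.clam_cong (.lapp_cong ?_ (.refl (dK.shift _)))))
  have := EEq.vlam_beta (Γ := cbvcpsT R σ :: cbvcpsCtx R Θ)
    ((cbvcps_deriv R dN).rename ((RenTyped.succ (cbvcpsCtx R Θ) (cbvcpsT R σ)).lift _))
    (.var _ 0 _ rfl)
  rwa [Tm.subst0_var_zero_rename] at this

/-! ### Values and substitution -/

theorem LVal.isPure {V : LTm} (h : LVal V) (d : LDeriv Θ V σ) : ∃ v, IsPure R d v := by
  induction h generalizing σ with
  | var => cases d with | var _ _ _ h => exact ⟨_, .var h⟩
  | unit => cases d; exact ⟨_, .unit⟩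
  | lam => cases d with | lam _ _ _ _ d => exact ⟨_, .lam d⟩
  | pair _ _ ih₁ ih₂ =>
      cases d with
      | pair _ _ _ _ _ d₁ d₂ =>
          obtain ⟨v, p⟩ := ih₁ d₁
          obtain ⟨w, q⟩ := ih₂ d₂
          exact ⟨_, p.pair q⟩

/-- Substituting pure terms commutes with the translation. -/
theorem cbvcps_psubst {Θ' : List STy} {s : ℕ → LTm} {s' : ℕ → Tm} (d : LDeriv Θ M τ)
    (ds : SubDeriv s Θ Θ') (hs : ∀ n σ h, IsPure R (ds n σ h) (s' n)) :
    EEq (cbvcpsCtx R Θ') none (cbvcps R (d.psubst ds)) ((cbvcps R d).psubst s')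
      (.lin (contT R τ) R) := by
  have lift {Θ Θ' : List STy} {s : ℕ → LTm} {s' : ℕ → Tm} {ds : SubDeriv s Θ Θ'}
      (hs : ∀ n σ h, IsPure R (ds n σ h) (s' n)) (ρ : STy) :
      ∀ n σ h, IsPure R (ds.lift ρ n σ h) (Tm.liftS s' n)
    | 0, σ, h => IsPure.var (Θ := ρ :: Θ') (n := 0) h
    | n + 1, σ, h => (hs n σ h).shift ρ
  induction d generalizing Θ' s s' with
  | var Θ n σ h => exact (hs n σ h).2
  | unit => exact .refl (cbvcps_deriv R (.unit _))
  | pair Θ M N σ τ d e ih₁ ih₂ =>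
      simp only [cbvcps, LDeriv.psubst, Tm.psubst, Tm.psubst_liftS_shift]
      exact .llam_cong (.lapp_cong (ih₁ ds hs) (.clam_cong (.lapp_cong ((ih₂ ds hs).shift _)
        (.refl (.clam _ _ _ _ _ (.capp _ _ _ _ _ _ (.svar _ _)
          (.vpair _ _ _ _ _ (.var _ _ _ rfl) (.var _ _ _ rfl))))))))
  | fst Θ M σ τ d ih =>
      simp only [cbvcps, LDeriv.psubst, Tm.psubst]
      exact .llam_cong (.lapp_cong (ih ds hs) (.refl (.clam _ _ _ _ _
        (.capp _ _ _ _ _ _ (.svar _ _) (.vfst _ _ _ (cbvcpsT R τ) (.var _ _ _ rfl))))))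
  | snd Θ M σ τ d ih =>
      simp only [cbvcps, LDeriv.psubst, Tm.psubst]
      exact .llam_cong (.lapp_cong (ih ds hs) (.refl (.clam _ _ _ _ _
        (.capp _ _ _ _ _ _ (.svar _ _) (.vsnd _ _ (cbvcpsT R σ) _ (.var _ _ _ rfl))))))
  | lam Θ M σ τ d ih =>
      exact .llam_cong (.capp_cong (.refl (.svar _ _))
        (.vlam_cong (ih (ds.lift σ) (lift hs σ))))
  | app Θ M N σ τ d e ih₁ ih₂ =>
      simp only [cbvcps, LDeriv.psubst, Tm.psubst, Tm.psubst_liftS_shift]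
      exact .llam_cong (.lapp_cong (ih₁ ds hs) (.clam_cong (.lapp_cong ((ih₂ ds hs).shift _)
        (.refl (.clam _ _ _ _ _ (.lapp _ _ _ _ _ _
          (.vapp _ _ _ _ _ (.var _ _ _ rfl) (.var _ _ _ rfl)) (.svar _ _)))))))

theorem cbvcps_subst0 (d : LDeriv (σ :: Θ) M τ) {dN : LDeriv Θ N σ} (p : IsPure R dN v) :
    EEq (cbvcpsCtx R Θ) none (cbvcps R (d.psubst (.single dN))) (Tm.subst0 v (cbvcps R d))
      (.lin (contT R τ) R) := by
  rw [Tm.subst0_eq]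
  refine cbvcps_psubst d _ ?_
  rintro (_ | n) ρ h
  · cases h
    exact p
  · exact IsPure.var (n := n) h

/-! ### Soundness of the laws of the computational λ-calculus -/

theorem cbvcps_beta_v (dM : LDeriv (σ :: Θ) M τ) {dN : LDeriv Θ N σ} (p : IsPure R dN v) :
    EEq (cbvcpsCtx R Θ) none
      (cbvcps R (.app Θ (.lam σ M) N σ τ (.lam Θ M σ τ dM) dN))
      (cbvcps R (dM.psubst (.single dN))) (.lin (contT R τ) R) := by
  refine cbvcps_ext _ _ ?_
  have body : Deriv (cbvcpsT R σ :: cbvcpsCtx R Θ) (some (contT R τ))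
      (.lapp (cbvcps R dM) .svar) (.comp R) :=
    .lapp _ _ _ _ _ _ (cbvcps_deriv R dM) (.svar _ _)
  exact (cbvcps_let_lapp dM dN (.svar _ _)).trans ((p.lapp (.clam _ _ _ _ _ body)).trans
    ((EEq.clam_beta body p.1.some).trans
      (.lapp_cong (cbvcps_subst0 dM p).symm (.refl (.svar _ _)))))

theorem cbvcps_eta_v {dM : LDeriv Θ M (.arr σ τ)} (p : IsPure R dM v) :
    EEq (cbvcpsCtx R Θ) none
      (cbvcps R (.lam Θ (.app M.shift (.var 0)) σ τ
        (.app _ _ _ σ τ (dM.shift σ) (.var _ 0 σ rfl))))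
      (cbvcps R dM) (.lin (contT R (.arr σ τ)) R) :=
  ((IsPure.lam _).congr p.1.some
    ((EEq.vlam_cong ((p.shift σ).app (.var rfl))).trans (.vlam_eta p.1.some))).eq p

theorem cbvcps_let_eta (dM : LDeriv Θ M σ) :
    EEq (cbvcpsCtx R Θ) none
      (cbvcps R (.app Θ (.lam σ (.var 0)) M σ σ (.lam _ _ _ _ (.var _ 0 σ rfl)) dM))
      (cbvcps R dM) (.lin (contT R σ) R) :=
  cbvcps_ext _ _ <| (cbvcps_let_lapp _ dM (.svar _ _)).trans <|
    .lapp_cong (.refl (cbvcps_deriv R dM)) <|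
      (EEq.clam_cong ((IsPure.var (Θ := σ :: Θ) rfl).lapp (.svar _ _))).trans
        (.clam_eta (.svar _ _))

theorem cbvcps_let_assoc {L : LTm} (dM : LDeriv (σ :: Θ) M τ) (dN : LDeriv (ρ :: Θ) N σ)
    (dL : LDeriv Θ L ρ) :
    EEq (cbvcpsCtx R Θ) none
      (cbvcps R (.app Θ _ _ σ τ (.lam _ _ _ _ dM) (.app _ _ _ ρ σ (.lam _ _ _ _ dN) dL)))
      (cbvcps R (.app Θ _ _ ρ τ (.lam _ _ _ _ (.app _ _ _ σ τ
        (.lam _ _ _ _ (dM.rename ((RenTyped.succ Θ ρ).lift σ))) dN)) dL))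
      (.lin (contT R τ) R) := by
  refine cbvcps_ext _ _ ((cbvcps_let_lapp dM _ (.svar _ _)).trans
    ((cbvcps_let_lapp dN dL (.clam _ _ _ _ _
      (.lapp _ _ _ _ _ _ (cbvcps_deriv R dM) (.svar _ _)))).trans ?_))
  refine .trans ?_ (cbvcps_let_lapp _ dL (.svar _ _)).symm
  refine .lapp_cong (.refl (cbvcps_deriv R dL)) (.clam_cong ?_)
  refine .trans ?_ (cbvcps_let_lapp _ dN (.svar _ _)).symm
  rw [cbvcps_rename]
  exact .refl (.lapp _ _ _ _ _ _ (cbvcps_deriv R dN) (.clam _ _ _ _ _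
    (.lapp _ _ _ _ _ _ ((cbvcps_deriv R dM).rename ((RenTyped.succ _ _).lift _)) (.svar _ _))))

/-- A term that evaluates `M` first can be rewritten to bind `M` by a `let`. -/
theorem cbvcps_eq_let {P : LTm} {dP : LDeriv Θ P τ} (dM : LDeriv Θ M σ) (dN : LDeriv (σ :: Θ) N τ)
    {t : Tm}
    (hP : EEq (cbvcpsCtx R Θ) (some (contT R τ)) (.lapp (cbvcps R dP) .svar)
      (.lapp (cbvcps R dM) (.clam (cbvcpsT R σ) t)) (.comp R))
    (hN : EEq (cbvcpsT R σ :: cbvcpsCtx R Θ) (some (contT R τ)) (.lapp (cbvcps R dN) .svar) t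
      (.comp R)) :
    EEq (cbvcpsCtx R Θ) none (cbvcps R dP)
      (cbvcps R (.app Θ (.lam σ N) M σ τ (.lam Θ N σ τ dN) dM)) (.lin (contT R τ) R) :=
  cbvcps_ext _ _ <| hP.trans <| .trans
    (.lapp_cong (.refl (cbvcps_deriv R dM)) (.clam_cong hN.symm))
    (cbvcps_let_lapp dN dM (.svar _ _)).symm

theorem cbvcps_app_left (dM : LDeriv Θ M (.arr σ τ)) (dN : LDeriv Θ N σ) :
    EEq (cbvcpsCtx R Θ) none (cbvcps R (.app Θ M N σ τ dM dN))
      (cbvcps R (.app Θ _ M _ τ (.lam _ _ _ _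
        (.app _ _ _ σ τ (.var _ 0 (.arr σ τ) rfl) (dN.shift (.arr σ τ)))) dM))
      (.lin (contT R τ) R) := by
  refine cbvcps_eq_let dM _ (cbvcps_app_lapp dM dN (.svar _ _)) ?_
  have := (IsPure.var (R := R) (Θ := .arr σ τ :: Θ) (n := 0) rfl).app_lapp
    (dN.shift (.arr σ τ)) (.svar _ (contT R τ))
  rwa [cbvcps_shift] at this

theorem cbvcps_app_right {dM : LDeriv Θ M (.arr σ τ)} (p : IsPure R dM v) (dN : LDeriv Θ N σ) :
    EEq (cbvcpsCtx R Θ) none (cbvcps R (.app Θ M N σ τ dM dN))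
      (cbvcps R (.app Θ _ N _ τ (.lam _ _ _ _
        (.app _ _ _ σ τ (dM.shift σ) (.var _ 0 σ rfl))) dN))
      (.lin (contT R τ) R) :=
  cbvcps_eq_let dN _ (p.app_lapp dN (.svar _ _))
    (.lapp_cong ((p.shift σ).app (.var rfl)) (.refl (.svar _ _)))

theorem cbvcps_pair_left (dM : LDeriv Θ M σ) (dN : LDeriv Θ N τ) :
    EEq (cbvcpsCtx R Θ) none (cbvcps R (.pair Θ M N σ τ dM dN))
      (cbvcps R (.app Θ _ M _ _ (.lam _ _ _ _
        (.pair _ _ _ σ τ (.var _ 0 σ rfl) (dN.shift σ))) dM))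
      (.lin (contT R (.prod σ τ)) R) := by
  refine cbvcps_eq_let dM _ (cbvcps_pair_lapp dM dN (.svar _ _)) ?_
  have := (IsPure.var (R := R) (Θ := σ :: Θ) (n := 0) rfl).pair_lapp
    (dN.shift σ) (.svar _ (contT R (.prod σ τ)))
  rwa [cbvcps_shift] at this

theorem cbvcps_pair_right {dM : LDeriv Θ M σ} (p : IsPure R dM v) (dN : LDeriv Θ N τ) :
    EEq (cbvcpsCtx R Θ) none (cbvcps R (.pair Θ M N σ τ dM dN))
      (cbvcps R (.app Θ _ N _ _ (.lam _ _ _ _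
        (.pair _ _ _ σ τ (dM.shift τ) (.var _ 0 τ rfl))) dN))
      (.lin (contT R (.prod σ τ)) R) :=
  cbvcps_eq_let dN _ (p.pair_lapp dN (.svar _ _))
    (((p.shift τ).pair (.var rfl)).lapp (.svar _ _))

theorem cbvcps_fst_cc (dM : LDeriv Θ M (.prod σ τ)) :
    EEq (cbvcpsCtx R Θ) none (cbvcps R (.fst Θ M σ τ dM))
      (cbvcps R (.app Θ _ M _ _ (.lam _ _ _ _ (.fst _ _ σ τ (.var _ 0 (.prod σ τ) rfl))) dM))
      (.lin (contT R σ) R) :=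
  cbvcps_eq_let dM _ (cbvcps_fst_lapp dM (.svar _ _))
    ((IsPure.var (Θ := .prod σ τ :: Θ) (n := 0) rfl).fst.lapp (.svar _ _))

theorem cbvcps_snd_cc (dM : LDeriv Θ M (.prod σ τ)) :
    EEq (cbvcpsCtx R Θ) none (cbvcps R (.snd Θ M σ τ dM))
      (cbvcps R (.app Θ _ M _ _ (.lam _ _ _ _ (.snd _ _ σ τ (.var _ 0 (.prod σ τ) rfl))) dM))
      (.lin (contT R τ) R) :=
  cbvcps_eq_let dM _ (cbvcps_snd_lapp dM (.svar _ _))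
    ((IsPure.var (Θ := .prod σ τ :: Θ) (n := 0) rfl).snd.lapp (.svar _ _))

/-- Terms equal in the computational λ-calculus have typing derivations with equal
translations. -/
theorem LamC.exists_cbvcps_eq (R : CType) (h : LamC Θ M N τ) :
    ∃ (dM : LDeriv Θ M τ) (dN : LDeriv Θ N τ),
      EEq (cbvcpsCtx R Θ) none (cbvcps R dM) (cbvcps R dN) (.lin (contT R τ) R) := by
  induction h with
  | refl d => exact ⟨d, d, .refl (cbvcps_deriv R d)⟩
  | symm _ ih => exact let ⟨d, e, h⟩ := ih; ⟨e, d, h.symm⟩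
  | trans _ _ ih₁ ih₂ =>
      obtain ⟨d, e, h⟩ := ih₁
      obtain ⟨e', d', h'⟩ := ih₂
      obtain rfl := e.eq e'
      exact ⟨d, d', h.trans h'⟩
  | pair_cong _ _ ih₁ ih₂ =>
      obtain ⟨d, d', h⟩ := ih₁
      obtain ⟨e, e', h'⟩ := ih₂
      exact ⟨.pair _ _ _ _ _ d e, .pair _ _ _ _ _ d' e', .llam_cong (.lapp_cong h
        (.clam_cong (.lapp_cong (h'.shift _) (.refl (.clam _ _ _ _ _
          (.capp _ _ _ _ _ _ (.svar _ _)
            (.vpair _ _ _ _ _ (.var _ _ _ rfl) (.var _ _ _ rfl))))))))⟩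
  | @fst_cong _ _ _ σ τ _ ih =>
      obtain ⟨d, d', h⟩ := ih
      exact ⟨.fst _ _ _ _ d, .fst _ _ _ _ d', .llam_cong (.lapp_cong h
        (.refl (.clam _ _ _ _ _ (.capp _ _ _ _ _ _ (.svar _ _)
          (.vfst _ _ _ (cbvcpsT R τ) (.var _ _ _ rfl))))))⟩
  | @snd_cong _ _ _ σ τ _ ih =>
      obtain ⟨d, d', h⟩ := ih
      exact ⟨.snd _ _ _ _ d, .snd _ _ _ _ d', .llam_cong (.lapp_cong h
        (.refl (.clam _ _ _ _ _ (.capp _ _ _ _ _ _ (.svar _ _)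
          (.vsnd _ _ (cbvcpsT R σ) _ (.var _ _ _ rfl))))))⟩
  | lam_cong _ ih =>
      obtain ⟨d, d', h⟩ := ih
      exact ⟨.lam _ _ _ _ d, .lam _ _ _ _ d',
        .llam_cong (.capp_cong (.refl (.svar _ _)) (.vlam_cong h))⟩
  | app_cong _ _ ih₁ ih₂ =>
      obtain ⟨d, d', h⟩ := ih₁
      obtain ⟨e, e', h'⟩ := ih₂
      exact ⟨.app _ _ _ _ _ d e, .app _ _ _ _ _ d' e', .llam_cong (.lapp_cong h
        (.clam_cong (.lapp_cong (h'.shift _) (.refl (.clam _ _ _ _ _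
          (.lapp _ _ _ _ _ _ (.vapp _ _ _ _ _ (.var _ _ _ rfl) (.var _ _ _ rfl))
            (.svar _ _)))))))⟩
  | beta_v d e hV =>
      obtain ⟨v, p⟩ := hV.isPure (R := R) e
      exact ⟨_, _, cbvcps_beta_v d p⟩
  | eta_v hV d =>
      obtain ⟨v, p⟩ := hV.isPure (R := R) d
      exact ⟨_, _, cbvcps_eta_v p⟩
  | fst_beta_v hV hW d e =>
      obtain ⟨v, p⟩ := hV.isPure (R := R) d
      obtain ⟨w, q⟩ := hW.isPure (R := R) e
      exact ⟨_, _, ((p.pair q).fst.congr p.1.some (.vfst_beta p.1.some q.1.some)).eq p⟩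
  | snd_beta_v hV hW d e =>
      obtain ⟨v, p⟩ := hV.isPure (R := R) d
      obtain ⟨w, q⟩ := hW.isPure (R := R) e
      exact ⟨_, _, ((p.pair q).snd.congr q.1.some (.vsnd_beta p.1.some q.1.some)).eq q⟩
  | pair_eta_v hV d =>
      obtain ⟨v, p⟩ := hV.isPure (R := R) d
      exact ⟨_, _, ((p.fst.pair p.snd).congr p.1.some (.vpair_eta p.1.some)).eq p⟩
  | unit_eta_v hV d =>
      obtain ⟨v, p⟩ := hV.isPure (R := R) d
      exact ⟨_, _, (p.congr (.unit _) (.unit_eta p.1.some)).eq .unit⟩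
  | let_eta d => exact ⟨_, _, cbvcps_let_eta d⟩
  | let_assoc dM dN dL => exact ⟨_, _, cbvcps_let_assoc dM dN dL⟩
  | app_left d e => exact ⟨_, _, cbvcps_app_left d e⟩
  | app_right hV d e =>
      obtain ⟨v, p⟩ := hV.isPure (R := R) d
      exact ⟨_, _, cbvcps_app_right p e⟩
  | pair_left d e => exact ⟨_, _, cbvcps_pair_left d e⟩
  | pair_right hV d e =>
      obtain ⟨v, p⟩ := hV.isPure (R := R) d
      exact ⟨_, _, cbvcps_pair_right p e⟩
  | fst_cc d => exact ⟨_, _, cbvcps_fst_cc d⟩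
  | snd_cc d => exact ⟨_, _, cbvcps_snd_cc d⟩

end

/-- **Soundness of the call-by-value linear-use CPS translation**
(Proposition 4.1): if `Θ ⊢ M =_{λc} N : τ` then
`Θᵛᶜ ⊢ Mᵛᶜ = Nᵛᶜ : (τᵛᶜ ⇒ R̲) ⊸ R̲` in the equational theory of EEC. -/
theorem cbvcps_sound (R : CType) (Θ : List STy) (M N : LTm) (τ : STy)
    (h : LamC Θ M N τ) (dM : LDeriv Θ M τ) (dN : LDeriv Θ N τ) :
    EEq (cbvcpsCtx R Θ) none (cbvcps R dM) (cbvcps R dN)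
      (.lin (.carr (cbvcpsT R τ) R) R) := by
  obtain ⟨d, e, h'⟩ := h.exists_cbvcps_eq R
  rwa [dM.eq d, dN.eq e]

end EEC
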